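/- Let Ω ⊂ ℝⁿ be a bounded John domain with n ≥ 3. Then there exists a constant C such that ‖v‖_{W^{1,2}(Ω)} ≤ C { ‖v‖_{L²(Ω)} + ‖l(v)‖_{L²(Ω)} } for all v ∈ W^{1,2}(Ω, ℝⁿ). -/

import Mathlib

open MeasureTheory Metric Set Matrix
open scoped BigOperators ENNReal

noncomputable section

abbrev Euc (n : ℕ) := EuclideanSpace ℝ (Fin n)

/-- Differential matrix `(Dv)_{ij} = ∂v_i/∂x_j` (computed via the Fréchet derivative). -/
def Dmat {n : ℕ} (v : Euc n → Euc n) (x : Euc n) : Matrix (Fin n) (Fin n) ℝ :=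
  fun i j => fderiv ℝ v x (EuclideanSpace.single j 1) i

/-- Symmetric part of the differential matrix. -/
def epsMat {n : ℕ} (v : Euc n → Euc n) (x : Euc n) : Matrix (Fin n) (Fin n) ℝ :=
  (1 / 2 : ℝ) • (Dmat v x + (Dmat v x)ᵀ)

/-- Trace-free part of the symmetric part of the differential matrix. -/
def lMat {n : ℕ} (v : Euc n → Euc n) (x : Euc n) : Matrix (Fin n) (Fin n) ℝ :=
  epsMat v x - (Matrix.trace (Dmat v x) / (n : ℝ)) • (1 : Matrix (Fin n) (Fin n) ℝ)

/-- Frobenius (Euclidean) norm of a matrix. -/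
def matNorm {n : ℕ} (M : Matrix (Fin n) (Fin n) ℝ) : ℝ :=
  Real.sqrt (∑ i, ∑ j, (M i j) ^ 2)

/-- `M : N = Σ_{ij} M_{ij} N_{ij}`. -/
def matDot {n : ℕ} (M N : Matrix (Fin n) (Fin n) ℝ) : ℝ := ∑ i, ∑ j, M i j * N i j

/-- Distance to the boundary of `Ω`. -/
def distBd {n : ℕ} (Ω : Set (Euc n)) (x : Euc n) : ℝ := Metric.infDist x (frontier Ω)

/-- Open axis-parallel cube with center `c` and side length `h`. -/
def openCube {n : ℕ} (c : Euc n) (h : ℝ) : Set (Euc n) := {x | ∀ i, |x i - c i| < h / 2}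

/-- Closed axis-parallel cube with center `c` and side length `h`. -/
def closedCube {n : ℕ} (c : Euc n) (h : ℝ) : Set (Euc n) := {x | ∀ i, |x i - c i| ≤ h / 2}

/-- Bounded John domain: there are `C > 1` and a distinguished point `x₀ ∈ Ω` such that
every point of `Ω` is joined to `x₀` by a rectifiable curve, parameterized by arc length
(hence 1-Lipschitz), along which the distance to the boundary grows linearly. -/
def IsJohnDomain {n : ℕ} (Ω : Set (Euc n)) : Prop :=
  ∃ C > (1 : ℝ), ∃ x₀ ∈ Ω, ∀ y ∈ Ω, ∃ L : ℝ, 0 ≤ L ∧ ∃ γ : ℝ → Euc n,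
    γ 0 = y ∧ γ L = x₀ ∧ (∀ t ∈ Icc 0 L, γ t ∈ Ω) ∧
    (∀ s ∈ Icc 0 L, ∀ t ∈ Icc 0 L, dist (γ s) (γ t) ≤ |s - t|) ∧
    (∀ t ∈ Icc 0 L, t / C ≤ Metric.infDist (γ t) (frontier Ω))

/-- The matrix-valued functions `H_i`. -/
def Hmat {n : ℕ} (i : Fin n) (z : Euc n) : Matrix (Fin n) (Fin n) ℝ :=
  fun j k => if j = k then z i else if k = i then z j else if j = i then -z k else 0

/-- The finite-dimensional space `V = D(Σ)`:
`φ(x) = A + λ I + Σ_i b_i H_i(x − y)` with `A` skew-symmetric. -/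
def Vset (n : ℕ) : Set (Euc n → Matrix (Fin n) (Fin n) ℝ) :=
  {φ | ∃ (A : Matrix (Fin n) (Fin n) ℝ) (lam : ℝ) (b : Fin n → ℝ) (y : Euc n),
    Aᵀ = -A ∧ ∀ x, φ x = A + lam • (1 : Matrix (Fin n) (Fin n) ℝ) + ∑ i, b i • Hmat i (x - y)}


/-- Membership in the (strong form of the) Sobolev space `W^{1,p}(Ω, ℝⁿ)`. -/
def memW1p {n : ℕ} (Ω : Set (Euc n)) (p : ℝ) (v : Euc n → Euc n) : Prop :=
  (∀ x ∈ Ω, DifferentiableAt ℝ v x) ∧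
  IntegrableOn (fun x => ‖v x‖ ^ p) Ω ∧
  IntegrableOn (fun x => matNorm (Dmat v x) ^ p) Ω

/-- `‖v‖_{L^p(Ω)}`. -/
def LpNorm {n : ℕ} (Ω : Set (Euc n)) (p : ℝ) (v : Euc n → Euc n) : ℝ :=
  (∫ x in Ω, ‖v x‖ ^ p) ^ (1 / p)

/-- `‖v‖_{W^{1,p}(Ω)} = (‖v‖_{L^p}^p + ‖Dv‖_{L^p}^p)^{1/p}`. -/
def W1pNorm {n : ℕ} (Ω : Set (Euc n)) (p : ℝ) (v : Euc n → Euc n) : ℝ :=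
  ((∫ x in Ω, ‖v x‖ ^ p) + ∫ x in Ω, matNorm (Dmat v x) ^ p) ^ (1 / p)

/-- `Σ`, the kernel of `l` inside `W^{1,p}(Ω, ℝⁿ)`. -/
def memSigma {n : ℕ} (Ω : Set (Euc n)) (p : ℝ) (w : Euc n → Euc n) : Prop :=
  memW1p Ω p w ∧ ∀ x ∈ Ω, lMat w x = 0

/-- Squared Frobenius norm of a square array. -/
def frobSq {n : ℕ} (P : Fin n → Fin n → ℝ) : ℝ := ∑ i, ∑ j, P i j ^ 2

/-- Trace-free symmetric part of a square array. -/
def tfSym {n : ℕ} (P : Fin n → Fin n → ℝ) : Fin n → Fin n → ℝ :=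
  fun i j => (P i j + P j i) / 2 - if i = j then (∑ k, P k k) / (n : ℝ) else 0

/-- Partial derivative in the `i`-th coordinate direction. -/
def pd {n : ℕ} (i : Fin n) (f : Euc n → ℝ) (x : Euc n) : ℝ :=
  fderiv ℝ f x (EuclideanSpace.single i 1)

/-- Jacobian array of a tuple of scalar functions. -/
def jac {n : ℕ} (u : Fin n → Euc n → ℝ) (x : Euc n) : Fin n → Fin n → ℝ :=
  fun i j => pd j (u i) x

lemma frobSq_nonneg {n : ℕ} (P : Fin n → Fin n → ℝ) : 0 ≤ frobSq P :=
  Finset.sum_nonneg fun _ _ => Finset.sum_nonneg fun _ _ => sq_nonneg _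

lemma sq_le_frobSq {n : ℕ} (P : Fin n → Fin n → ℝ) (i j : Fin n) : P i j ^ 2 ≤ frobSq P :=
  (Finset.single_le_sum (f := fun j => P i j ^ 2) (fun _ _ => sq_nonneg _)
    (Finset.mem_univ j)).trans
    (Finset.single_le_sum (f := fun i => ∑ j, P i j ^ 2)
      (fun _ _ => Finset.sum_nonneg fun _ _ => sq_nonneg _) (Finset.mem_univ i))

lemma frobSq_add_le {n : ℕ} (P Q : Fin n → Fin n → ℝ) :
    frobSq (P + Q) ≤ 2 * frobSq P + 2 * frobSq Q := by
  simp only [frobSq, Finset.mul_sum, ← Finset.sum_add_distrib]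
  refine Finset.sum_le_sum fun i _ => Finset.sum_le_sum fun j _ => ?_
  simp only [Pi.add_apply]
  nlinarith [sq_nonneg (P i j - Q i j)]

lemma frobSq_sub_le {n : ℕ} (P Q : Fin n → Fin n → ℝ) :
    frobSq (P - Q) ≤ 2 * frobSq P + 2 * frobSq Q := by
  simp only [frobSq, Finset.mul_sum, ← Finset.sum_add_distrib]
  refine Finset.sum_le_sum fun i _ => Finset.sum_le_sum fun j _ => ?_
  simp only [Pi.sub_apply]
  nlinarith [sq_nonneg (P i j + Q i j)]

lemma frobSq_smul {n : ℕ} (c : ℝ) (P : Fin n → Fin n → ℝ) :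
    frobSq (c • P) = c ^ 2 * frobSq P := by
  simp only [frobSq, Finset.mul_sum, Pi.smul_apply, smul_eq_mul, mul_pow]

lemma tfSym_add {n : ℕ} (P Q : Fin n → Fin n → ℝ) : tfSym (P + Q) = tfSym P + tfSym Q := by
  ext i j
  simp only [tfSym, Pi.add_apply, Finset.sum_add_distrib]
  split_ifs <;> ring

lemma tfSym_sub {n : ℕ} (P Q : Fin n → Fin n → ℝ) : tfSym (P - Q) = tfSym P - tfSym Q := by
  ext i j
  simp only [tfSym, Pi.sub_apply, Finset.sum_sub_distrib]
  split_ifs <;> ring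

lemma tfSym_smul {n : ℕ} (c : ℝ) (P : Fin n → Fin n → ℝ) : tfSym (c • P) = c • tfSym P := by
  ext i j
  simp only [tfSym, Pi.smul_apply, smul_eq_mul, ← Finset.mul_sum]
  split_ifs <;> ring

lemma frobSq_tfSym {n : ℕ} (hn : n ≠ 0) (P : Fin n → Fin n → ℝ) :
    frobSq (tfSym P) = frobSq P / 2 + (∑ i, ∑ j, P i j * P j i) / 2
      - (∑ k, P k k) ^ 2 / n := by
  have hn' : (n : ℝ) ≠ 0 := Nat.cast_ne_zero.2 hn
  set t := ∑ k, P k k with ht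
  have h1 : ∀ i j, tfSym P i j ^ 2 = P i j ^ 2 / 4 + P j i ^ 2 / 4 + P i j * P j i / 2
      + if i = j then (-2 * P i i * (t / n) + (t / n) ^ 2) else 0 := by
    intro i j
    simp only [tfSym, ← ht]
    split_ifs with h
    · subst h; ring
    · ring
  have h2 : ∑ i, ∑ j, P j i ^ 2 = frobSq P := Finset.sum_comm
  simp only [frobSq] at h2 ⊢
  simp only [h1, Finset.sum_add_distrib, Finset.sum_ite_eq, Finset.mem_univ, if_true,
    ← Finset.sum_div, ← Finset.sum_mul, ← Finset.mul_sum, h2, ← ht]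
  simp only [Finset.sum_const, Finset.card_univ, Fintype.card_fin, nsmul_eq_mul]
  field_simp
  ring

lemma sum_mul_transpose_le {n : ℕ} (P : Fin n → Fin n → ℝ) :
    ∑ i, ∑ j, P i j * P j i ≤ frobSq P := by
  have h2 : ∑ i, ∑ j, P j i ^ 2 = frobSq P := Finset.sum_comm
  have h : ∑ i, ∑ j, P i j * P j i ≤ ∑ i, ∑ j, (P i j ^ 2 / 2 + P j i ^ 2 / 2) :=
    Finset.sum_le_sum fun i _ => Finset.sum_le_sum fun j _ => by
      nlinarith [sq_nonneg (P i j - P j i)]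
  simp only [Finset.sum_add_distrib, ← Finset.sum_div, h2] at h
  change _ ≤ frobSq P / 2 + _ at h
  linarith

lemma frobSq_tfSym_le {n : ℕ} (P : Fin n → Fin n → ℝ) : frobSq (tfSym P) ≤ frobSq P := by
  rcases eq_or_ne n 0 with rfl | hn
  · simp [frobSq]
  rw [frobSq_tfSym hn]
  have := sum_mul_transpose_le P
  have : 0 ≤ (∑ k, P k k) ^ 2 / (n : ℝ) := by positivity
  linarith

/-- Smooth functions with compact support. -/
def IsTest {n : ℕ} (φ : Euc n → ℝ) : Prop :=
  ContDiff ℝ ((⊤ : ℕ∞) : WithTop ℕ∞) φ ∧ HasCompactSupport φ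

/-- Nonnegative smooth functions of integral one supported in the ball of radius `s`. -/
structure IsMoll {n : ℕ} (φ : Euc n → ℝ) (s : ℝ) : Prop where
  smooth : ContDiff ℝ ((⊤ : ℕ∞) : WithTop ℕ∞) φ
  nonneg : ∀ x, 0 ≤ φ x
  integral_eq_one : ∫ x, φ x = 1
  eq_zero : ∀ x, s < ‖x‖ → φ x = 0

/-- Convolution of scalar functions. -/
def cv {n : ℕ} (φ f : Euc n → ℝ) (x : Euc n) : ℝ := ∫ t, φ t * f (x - t)

lemma cv_eq_convolution {n : ℕ} (φ f : Euc n → ℝ) :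
    cv φ f = convolution φ f (ContinuousLinearMap.lsmul ℝ ℝ) volume := rfl

lemma IsMoll.isTest {n : ℕ} {φ : Euc n → ℝ} {s : ℝ} (h : IsMoll φ s) : IsTest φ :=
  ⟨h.smooth, HasCompactSupport.intro (isCompact_closedBall 0 s) fun x hx => h.eq_zero x (by
    simpa using hx)⟩

lemma IsTest.continuous {n : ℕ} {φ : Euc n → ℝ} (h : IsTest φ) : Continuous φ := h.1.continuous

lemma IsTest.differentiable {n : ℕ} {φ : Euc n → ℝ} (h : IsTest φ) : Differentiable ℝ φ :=
  h.1.differentiable (by simp)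

lemma IsTest.integrable {n : ℕ} {φ : Euc n → ℝ} (h : IsTest φ) : Integrable φ :=
  h.continuous.integrable_of_hasCompactSupport h.2

lemma contDiff_pd {n : ℕ} (i : Fin n) {f : Euc n → ℝ}
    (hf : ContDiff ℝ ((⊤ : ℕ∞) : WithTop ℕ∞) f) :
    ContDiff ℝ ((⊤ : ℕ∞) : WithTop ℕ∞) (pd i f) :=
  (hf.fderiv_right (m := ((⊤ : ℕ∞) : WithTop ℕ∞)) (by simp)).clm_apply contDiff_const

lemma hasCompactSupport_pd {n : ℕ} (i : Fin n) {f : Euc n → ℝ} (hf : HasCompactSupport f) :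
    HasCompactSupport (pd i f) :=
  hf.fderiv_apply (𝕜 := ℝ) _

lemma IsTest.pd {n : ℕ} {φ : Euc n → ℝ} (h : IsTest φ) (i : Fin n) : IsTest (pd i φ) :=
  ⟨contDiff_pd i h.1, hasCompactSupport_pd i h.2⟩

lemma pd_comm {n : ℕ} (i j : Fin n) {f : Euc n → ℝ}
    (hf : ContDiff ℝ ((⊤ : ℕ∞) : WithTop ℕ∞) f) : pd i (pd j f) = pd j (pd i f) := by
  ext x
  have hd : DifferentiableAt ℝ (fderiv ℝ f) x :=
    ((hf.fderiv_right (m := ((⊤ : ℕ∞) : WithTop ℕ∞)) (by simp)).differentiable (by simp)) x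
  have h : ∀ k l : Fin n, _root_.pd k (_root_.pd l f) x
      = fderiv ℝ (fderiv ℝ f) x (EuclideanSpace.single k 1) (EuclideanSpace.single l 1) := by
    intro k l
    have := (hd.hasFDerivAt.clm_apply (hasFDerivAt_const (EuclideanSpace.single l (1:ℝ)) x)).fderiv
    change fderiv ℝ (fun y => fderiv ℝ f y (EuclideanSpace.single l 1)) x _ = _
    rw [this]
    simp
  rw [h, h]
  have hs : IsSymmSndFDerivAt ℝ f x := hf.contDiffAt.isSymmSndFDerivAt (by
    simp only [minSmoothness_of_isRCLikeNormedField]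
    exact WithTop.coe_le_coe.2 (le_top : (2 : ℕ∞) ≤ ⊤))
  exact hs _ _

lemma IsTest.integrable_mul {n : ℕ} {φ f : Euc n → ℝ} (h : IsTest φ)
    (hf : LocallyIntegrable f) (x : Euc n) : Integrable fun t => φ t * f (x - t) :=
  h.2.convolutionExists_left (ContinuousLinearMap.lsmul ℝ ℝ) h.continuous hf x

lemma contDiff_cv {n : ℕ} {φ f : Euc n → ℝ} (h : IsTest φ) (hf : LocallyIntegrable f) :
    ContDiff ℝ ((⊤ : ℕ∞) : WithTop ℕ∞) (cv φ f) := by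
  rw [cv_eq_convolution]
  exact h.2.contDiff_convolution_left (ContinuousLinearMap.lsmul ℝ ℝ) h.1 hf

lemma hasCompactSupport_cv {n : ℕ} {φ f : Euc n → ℝ} (h : HasCompactSupport φ)
    (hf : HasCompactSupport f) : HasCompactSupport (cv φ f) :=
  HasCompactSupport.convolution (ContinuousLinearMap.lsmul ℝ ℝ) h hf

lemma pd_cv {n : ℕ} {φ f : Euc n → ℝ} (h : IsTest φ) (hf : LocallyIntegrable f) (i : Fin n) :
    pd i (cv φ f) = cv (pd i φ) f := by
  ext x
  have h1 := (h.2.hasFDerivAt_convolution_left (ContinuousLinearMap.lsmul ℝ ℝ)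
    (h.1.of_le (by simp)) hf x).fderiv
  have h3 : Integrable (fun t => ((ContinuousLinearMap.lsmul ℝ ℝ).precompL (Euc n))
      (fderiv ℝ φ t) (f (x - t))) volume :=
    (h.2.fderiv ℝ).convolutionExists_left _ (h.1.continuous_fderiv (by simp)) hf x
  rw [cv_eq_convolution, pd, h1, convolution_def, ContinuousLinearMap.integral_apply h3]
  rfl

lemma cv_pd {n : ℕ} {φ f : Euc n → ℝ} (h : IsTest φ) (hf : Differentiable ℝ f) (i : Fin n)
    (hf' : LocallyIntegrable (pd i f)) : cv (pd i φ) f = cv φ (pd i f) := by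
  ext x
  have hl : LocallyIntegrable f := hf.continuous.locallyIntegrable
  have hg : ∀ t, HasFDerivAt (fun t => f (x - t)) (-(fderiv ℝ f (x - t))) t := by
    intro t
    have := (hf (x - t)).hasFDerivAt.comp t ((hasFDerivAt_id t).const_sub x)
    refine HasFDerivAt.congr_fderiv this ?_
    ext v
    simp
  have hg' : ∀ t, fderiv ℝ (fun t => f (x - t)) t (EuclideanSpace.single i 1) =
      - pd i f (x - t) := by
    intro t; rw [(hg t).fderiv]; rfl
  have key := integral_mul_fderiv_eq_neg_fderiv_mul_of_integrable (μ := volume)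
    (f := fun t => f (x - t)) (g := φ) (v := EuclideanSpace.single i 1) ?_ ?_ ?_ ?_ ?_
  · simp only [hg'] at key
    simp only [neg_mul, integral_neg, neg_neg] at key
    calc cv (pd i φ) f x = ∫ t, f (x - t) * fderiv ℝ φ t (EuclideanSpace.single i 1) := by
          unfold cv; congr 1; ext t; rw [mul_comm]; rfl
      _ = ∫ t, pd i f (x - t) * φ t := key
      _ = _ := by unfold cv; congr 1; ext t; rw [mul_comm]
  · simp only [hg', neg_mul]
    refine ((h.integrable_mul hf' x).congr ?_).neg
    exact Filter.Eventually.of_forall fun t => mul_comm _ _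
  · refine ((h.pd i).integrable_mul hl x).congr ?_
    exact Filter.Eventually.of_forall fun t => mul_comm _ _
  · refine (h.integrable_mul hl x).congr ?_
    exact Filter.Eventually.of_forall fun t => mul_comm _ _
  · exact fun t _ => (hg t).differentiableAt
  · exact fun t _ => h.differentiable t

lemma pd_comp_smul {n : ℕ} (i : Fin n) {f : Euc n → ℝ} (hf : Differentiable ℝ f) (a c : ℝ) :
    pd i (fun x => a * f (c • x)) = fun x => (a * c) * pd i f (c • x) := by
  ext x
  have h0 : HasFDerivAt (fun x : Euc n => c • x) (c • ContinuousLinearMap.id ℝ (Euc n)) x :=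
    (hasFDerivAt_id x).const_smul c
  have h1 := (((hf (c • x)).hasFDerivAt.comp x h0).const_mul a).fderiv
  change fderiv ℝ (fun x => a * (f ∘ fun x => c • x) x) x _ = _
  rw [h1]
  simp [pd, mul_assoc]

lemma IsTest.bounded {n : ℕ} {φ : Euc n → ℝ} (h : IsTest φ) : ∃ C, ∀ x, |φ x| ≤ C :=
  h.2.exists_bound_of_continuous h.continuous

lemma exists_moll_unit (n : ℕ) : ∃ φ : Euc n → ℝ, IsMoll φ 1 := by
  let b : ContDiffBump (0 : Euc n) := ⟨1 / 2, 1, by norm_num, by norm_num⟩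
  refine ⟨b.normed volume, b.contDiff_normed, b.nonneg_normed, b.integral_normed, fun x hx => ?_⟩
  have : x ∉ Function.support (b.normed (volume : Measure (Euc n))) := by
    rw [b.support_normed_eq]
    simpa [b] using hx.le
  simpa using this

/-- A scaled family of mollifiers with uniform derivative bounds. -/
lemma exists_moll (n : ℕ) : ∃ C : ℝ, 0 < C ∧ ∀ s : ℝ, 0 < s → ∃ φ : Euc n → ℝ, IsMoll φ s ∧
    (∀ x, |φ x| ≤ C / s ^ n) ∧ (∀ a x, |pd a φ x| ≤ C / s ^ (n + 1)) ∧
    (∀ a b x, |pd a (pd b φ) x| ≤ C / s ^ (n + 2)) := by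
  obtain ⟨φ, hφ⟩ := exists_moll_unit n
  obtain ⟨C0, h0⟩ := hφ.isTest.bounded
  choose C1 h1 using fun a => (hφ.isTest.pd a).bounded
  choose C2 h2 using fun a b => ((hφ.isTest.pd b).pd a).bounded
  have hC0 : 0 ≤ C0 := (abs_nonneg _).trans (h0 0)
  have hC1 : ∀ a, 0 ≤ C1 a := fun a => (abs_nonneg _).trans (h1 a 0)
  have hC2 : ∀ a b, 0 ≤ C2 a b := fun a b => (abs_nonneg _).trans (h2 a b 0)
  have s1 : 0 ≤ ∑ a, C1 a := Finset.sum_nonneg fun a _ => hC1 a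
  have s2 : 0 ≤ ∑ a, ∑ b, C2 a b :=
    Finset.sum_nonneg fun a _ => Finset.sum_nonneg fun b _ => hC2 a b
  have t1 : ∀ a, C1 a ≤ ∑ a, C1 a := fun a =>
    Finset.single_le_sum (fun a _ => hC1 a) (Finset.mem_univ a)
  have t2 : ∀ a b, C2 a b ≤ ∑ a, ∑ b, C2 a b := fun a b =>
    (Finset.single_le_sum (f := fun b => C2 a b) (fun b _ => hC2 a b) (Finset.mem_univ b)).trans
    (Finset.single_le_sum (f := fun a => ∑ b, C2 a b)
      (fun a _ => Finset.sum_nonneg fun b _ => hC2 a b) (Finset.mem_univ a))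
  refine ⟨C0 + ∑ a, C1 a + ∑ a, ∑ b, C2 a b + 1, by positivity, fun s hs => ?_⟩
  have e1 : ∀ a, pd a (fun x => (s⁻¹) ^ n * φ (s⁻¹ • x)) =
      fun x => (s⁻¹) ^ (n + 1) * pd a φ (s⁻¹ • x) := fun a => by
    rw [pd_comp_smul a hφ.isTest.differentiable]; ext x; ring
  have e2 : ∀ a b, pd a (pd b (fun x => (s⁻¹) ^ n * φ (s⁻¹ • x))) =
      fun x => (s⁻¹) ^ (n + 2) * pd a (pd b φ) (s⁻¹ • x) := fun a b => by
    rw [e1, pd_comp_smul a (hφ.isTest.pd b).differentiable]; ext x; ring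
  have bd : ∀ (k : ℕ) (y D : ℝ), |y| ≤ D → |(s⁻¹) ^ k * y| ≤ D / s ^ k := by
    intro k y D h
    rw [abs_mul, abs_of_nonneg (by positivity), div_eq_inv_mul, inv_pow]
    gcongr
  refine ⟨fun x => (s⁻¹) ^ n * φ (s⁻¹ • x), ⟨?_, ?_, ?_, ?_⟩, ?_, ?_, ?_⟩
  · exact contDiff_const.mul (hφ.smooth.comp (contDiff_const_smul _))
  · exact fun x => mul_nonneg (by positivity) (hφ.nonneg _)
  · rw [integral_const_mul, Measure.integral_comp_smul, hφ.integral_eq_one]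
    simp only [finrank_euclideanSpace, Fintype.card_fin, smul_eq_mul, mul_one]
    rw [abs_of_nonneg (by positivity)]
    field_simp
  · intro x hx
    have : φ (s⁻¹ • x) = 0 := hφ.eq_zero _ (by
      rw [norm_smul, norm_inv, Real.norm_of_nonneg hs.le, ← div_eq_inv_mul, lt_div_iff₀ hs]
      simpa using hx)
    simp [this]
  · exact fun x => bd n _ _ ((h0 _).trans (by linarith))
  · intro a x
    rw [e1]
    exact bd _ _ _ ((h1 a _).trans (by linarith [t1 a]))
  · intro a b x
    rw [e2]
    exact bd _ _ _ ((h2 a b _).trans (by linarith [t2 a b]))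

lemma sq_lintegral_le {T : Type*} [MeasurableSpace T] (ν : Measure T) [IsProbabilityMeasure ν]
    {F : T → ℝ≥0∞} (hF : AEMeasurable F ν) : (∫⁻ t, F t ∂ν) ^ 2 ≤ ∫⁻ t, F t ^ 2 ∂ν := by
  have h := ENNReal.lintegral_mul_le_Lp_mul_Lq ν Real.HolderConjugate.two_two hF
    (aemeasurable_const (b := (1 : ℝ≥0∞)))
  simp only [Pi.mul_apply, mul_one, ENNReal.one_rpow, lintegral_const, measure_univ] at h
  have h2 := pow_le_pow_left' h 2
  refine h2.trans (le_of_eq ?_)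
  rw [← ENNReal.rpow_natCast, ← ENNReal.rpow_mul]
  norm_num

lemma enorm_sq_eq_ofReal (y : ℝ) : ‖y‖ₑ ^ 2 = ENNReal.ofReal (y ^ 2) := by
  rw [← sq_abs, ENNReal.ofReal_pow (abs_nonneg y), ← Real.enorm_eq_ofReal_abs]

/-- The probability measure with density a mollifier. -/
def mollMeasure {n : ℕ} (φ : Euc n → ℝ) : Measure (Euc n) :=
  volume.withDensity fun x => ENNReal.ofReal (φ x)

lemma IsMoll.isProbabilityMeasure {n : ℕ} {φ : Euc n → ℝ} {s : ℝ} (h : IsMoll φ s) :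
    IsProbabilityMeasure (mollMeasure φ) := by
  constructor
  rw [mollMeasure, withDensity_apply _ MeasurableSet.univ, Measure.restrict_univ,
    ← ofReal_integral_eq_lintegral_ofReal h.isTest.integrable
      (Filter.Eventually.of_forall h.nonneg), h.integral_eq_one, ENNReal.ofReal_one]

lemma IsMoll.lintegral_eq {n : ℕ} {φ : Euc n → ℝ} {s : ℝ} (h : IsMoll φ s) (F : Euc n → ℝ≥0∞) :
    ∫⁻ t, F t ∂(mollMeasure φ) = ∫⁻ t, ENNReal.ofReal (φ t) * F t := by
  rw [mollMeasure, lintegral_withDensity_eq_lintegral_mul_non_measurable]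
  · rfl
  · exact h.smooth.continuous.measurable.ennreal_ofReal
  · exact Filter.Eventually.of_forall fun _ => ENNReal.ofReal_lt_top

lemma IsMoll.ae_norm_le {n : ℕ} {φ : Euc n → ℝ} {s : ℝ} (h : IsMoll φ s) :
    ∀ᵐ t ∂(mollMeasure φ), ‖t‖ ≤ s := by
  rw [mollMeasure, ae_withDensity_iff h.smooth.continuous.measurable.ennreal_ofReal]
  refine Filter.Eventually.of_forall fun t ht => ?_
  by_contra hc
  exact ht (by rw [h.eq_zero t (not_le.1 hc), ENNReal.ofReal_zero])

lemma IsMoll.enorm_integral_le {n : ℕ} {φ : Euc n → ℝ} {s : ℝ} (h : IsMoll φ s)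
    (f : Euc n → ℝ) : ‖∫ t, φ t * f t‖ₑ ≤ ∫⁻ t, ‖f t‖ₑ ∂(mollMeasure φ) := by
  rw [h.lintegral_eq]
  refine (enorm_integral_le_lintegral_enorm _).trans (le_of_eq ?_)
  congr 1
  ext t
  rw [enorm_mul, Real.enorm_of_nonneg (h.nonneg t)]

lemma lintegral_ball_sub_le {n : ℕ} (F : Euc n → ℝ≥0∞) (x₀ : Euc n) (ρ s : ℝ) (t : Euc n)
    (ht : ‖t‖ ≤ s) : ∫⁻ x in ball x₀ ρ, F (x - t) ≤ ∫⁻ x in ball x₀ (ρ + s), F x := by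
  rw [← lintegral_indicator measurableSet_ball, ← lintegral_indicator measurableSet_ball,
    ← lintegral_sub_right_eq_self ((ball x₀ (ρ + s)).indicator F) t]
  refine lintegral_mono fun x => ?_
  by_cases hx : x ∈ ball x₀ ρ
  · have : x - t ∈ ball x₀ (ρ + s) := by
      rw [mem_ball, dist_eq_norm] at hx ⊢
      calc ‖x - t - x₀‖ = ‖(x - x₀) - t‖ := by congr 1; abel
        _ ≤ ‖x - x₀‖ + ‖t‖ := norm_sub_le _ _
        _ < ρ + s := by linarith
    simp [hx, this]
  · simp [hx]

lemma lintegral_sq_average_le {X T : Type*} [MeasurableSpace X] [MeasurableSpace T]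
    (μ : Measure X) [SFinite μ] (ν : Measure T) [IsProbabilityMeasure ν]
    {F : X → T → ℝ≥0∞} (hF : Measurable (Function.uncurry F)) {B : ℝ≥0∞}
    (hB : ∀ᵐ t ∂ν, ∫⁻ x, F x t ^ 2 ∂μ ≤ B) :
    ∫⁻ x, (∫⁻ t, F x t ∂ν) ^ 2 ∂μ ≤ B := by
  calc ∫⁻ x, (∫⁻ t, F x t ∂ν) ^ 2 ∂μ ≤ ∫⁻ x, ∫⁻ t, F x t ^ 2 ∂ν ∂μ :=
        lintegral_mono fun x => sq_lintegral_le ν (hF.of_uncurry_left).aemeasurable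
    _ = ∫⁻ t, ∫⁻ x, F x t ^ 2 ∂μ ∂ν := lintegral_lintegral_swap (hF.pow_const 2).aemeasurable
    _ ≤ ∫⁻ _, B ∂ν := lintegral_mono_ae hB
    _ = B := by simp

/-- Local contraction of convolution with a mollifier in `L²`. -/
lemma lintegral_cv_sq_le {n : ℕ} {φ : Euc n → ℝ} {s : ℝ} (h : IsMoll φ s) {f : Euc n → ℝ}
    (hf : Measurable f) (x₀ : Euc n) (ρ : ℝ) :
    ∫⁻ x in ball x₀ ρ, ‖cv φ f x‖ₑ ^ 2 ≤ ∫⁻ x in ball x₀ (ρ + s), ‖f x‖ₑ ^ 2 := by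
  have := h.isProbabilityMeasure
  calc ∫⁻ x in ball x₀ ρ, ‖cv φ f x‖ₑ ^ 2
      ≤ ∫⁻ x in ball x₀ ρ, (∫⁻ t, ‖f (x - t)‖ₑ ∂(mollMeasure φ)) ^ 2 :=
        lintegral_mono fun x => pow_le_pow_left' (h.enorm_integral_le fun t => f (x - t)) 2
    _ ≤ _ := lintegral_sq_average_le _ _ (F := fun x t => ‖f (x - t)‖ₑ)
      (hf.comp (measurable_fst.sub measurable_snd)).enorm
      (h.ae_norm_le.mono fun t ht => lintegral_ball_sub_le (fun x => ‖f x‖ₑ ^ 2) x₀ ρ s t ht)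

lemma fderiv_apply_sq_le {n : ℕ} (f : Euc n → ℝ) (x t : Euc n) :
    (fderiv ℝ f x t) ^ 2 ≤ ‖t‖ ^ 2 * ∑ i, pd i f x ^ 2 := by
  have h1 : fderiv ℝ f x t = ∑ i, t i * pd i f x := by
    conv_lhs => rw [← (EuclideanSpace.basisFun (Fin n) ℝ).sum_repr t]
    simp [pd, map_sum]
  rw [h1, EuclideanSpace.norm_sq_eq]
  simpa using Finset.sum_mul_sq_le_sq_mul_sq Finset.univ (fun i => t i) fun i => pd i f x

lemma lintegral_translate_sub_le {n : ℕ} {u : Euc n → ℝ} (hu : ContDiff ℝ 1 u)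
    (x₀ : Euc n) (ρ s : ℝ) (t : Euc n) (ht : ‖t‖ ≤ s) :
    ∫⁻ x in ball x₀ ρ, ‖u x - u (x - t)‖ₑ ^ 2 ≤
      ∫⁻ x in ball x₀ (ρ + s), ENNReal.ofReal (s ^ 2 * ∑ i, pd i u x ^ 2) := by
  have hs : 0 ≤ s := (norm_nonneg t).trans ht
  have hc : Continuous (fderiv ℝ u) := hu.continuous_fderiv (by simp)
  let ν : Measure ℝ := volume.restrict (Ioc 0 1)
  have : IsProbabilityMeasure ν := ⟨by simp [ν]⟩
  have hpt : ∀ x, ‖u x - u (x - t)‖ₑ ≤ ∫⁻ τ, ‖fderiv ℝ u (x - τ • t) t‖ₑ ∂ν := by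
    intro x
    have hd : ∀ τ : ℝ, HasDerivAt (fun τ : ℝ => u (x - τ • t)) (-(fderiv ℝ u (x - τ • t) t)) τ := by
      intro τ
      have h1 : HasDerivAt (fun τ : ℝ => x - τ • t) (-t) τ := by
        simpa using ((hasDerivAt_id τ).smul_const t).const_sub x
      have h2 := ((hu.differentiable (by simp)) (x - τ • t)).hasFDerivAt.comp_hasDerivAt τ h1
      rw [map_neg] at h2
      exact h2
    have hcont : Continuous fun τ : ℝ => -(fderiv ℝ u (x - τ • t) t) :=
      ((hc.comp (by fun_prop)).clm_apply continuous_const).neg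
    have h := intervalIntegral.integral_eq_sub_of_hasDerivAt (a := 0) (b := 1)
      (fun τ _ => hd τ) (hcont.intervalIntegrable _ _)
    have h' : u x - u (x - t) = ∫ τ in Ioc (0:ℝ) 1, fderiv ℝ u (x - τ • t) t := by
      rw [intervalIntegral.integral_of_le zero_le_one, integral_neg] at h
      simp only [one_smul, zero_smul, sub_zero] at h
      linarith
    rw [h']
    exact enorm_integral_le_lintegral_enorm _
  calc ∫⁻ x in ball x₀ ρ, ‖u x - u (x - t)‖ₑ ^ 2
      ≤ ∫⁻ x in ball x₀ ρ, (∫⁻ τ, ‖fderiv ℝ u (x - τ • t) t‖ₑ ∂ν) ^ 2 :=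
        lintegral_mono fun x => pow_le_pow_left' (hpt x) 2
    _ ≤ _ := by
      refine lintegral_sq_average_le _ _ (F := fun x τ => ‖fderiv ℝ u (x - τ • t) t‖ₑ) ?_ ?_
      · have : Continuous fun p : Euc n × ℝ => fderiv ℝ u (p.1 - p.2 • t) t :=
          (hc.comp (by fun_prop)).clm_apply continuous_const
        exact this.measurable.enorm
      · filter_upwards [ae_restrict_mem measurableSet_Ioc] with τ hτ
        have hτt : ‖τ • t‖ ≤ s := by
          rw [norm_smul, Real.norm_of_nonneg hτ.1.le]
          nlinarith [hτ.2, norm_nonneg t]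
        refine le_trans (lintegral_mono fun x => ?_) (lintegral_ball_sub_le
          (fun x => ENNReal.ofReal (s ^ 2 * ∑ i, pd i u x ^ 2)) x₀ ρ s (τ • t) hτt)
        rw [enorm_sq_eq_ofReal]
        refine ENNReal.ofReal_le_ofReal ((fderiv_apply_sq_le _ _ _).trans ?_)
        have : 0 ≤ ∑ i, pd i u (x - τ • t) ^ 2 := Finset.sum_nonneg fun _ _ => sq_nonneg _
        gcongr

/-- Local `L²` estimate of the difference between a function and its mollification. -/
lemma lintegral_sub_cv_sq_le {n : ℕ} {φ : Euc n → ℝ} {s : ℝ} (h : IsMoll φ s)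
    {u : Euc n → ℝ} (hu : ContDiff ℝ 1 u) (x₀ : Euc n) (ρ : ℝ) :
    ∫⁻ x in ball x₀ ρ, ‖u x - cv φ u x‖ₑ ^ 2 ≤
      ∫⁻ x in ball x₀ (ρ + s), ENNReal.ofReal (s ^ 2 * ∑ i, pd i u x ^ 2) := by
  have := h.isProbabilityMeasure
  have hpt : ∀ x, u x - cv φ u x = ∫ t, φ t * (u x - u (x - t)) := by
    intro x
    simp only [mul_sub]
    rw [integral_sub (h.isTest.integrable.mul_const _)
      (h.isTest.integrable_mul hu.continuous.locallyIntegrable x), integral_mul_const,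
      h.integral_eq_one, one_mul, cv]
  calc ∫⁻ x in ball x₀ ρ, ‖u x - cv φ u x‖ₑ ^ 2
      ≤ ∫⁻ x in ball x₀ ρ, (∫⁻ t, ‖u x - u (x - t)‖ₑ ∂(mollMeasure φ)) ^ 2 :=
        lintegral_mono fun x => by
          rw [hpt]; exact pow_le_pow_left' (h.enorm_integral_le fun t => u x - u (x - t)) 2
    _ ≤ _ := by
      refine lintegral_sq_average_le _ _ (F := fun x t => ‖u x - u (x - t)‖ₑ) ?_
        (h.ae_norm_le.mono fun t ht => lintegral_translate_sub_le hu x₀ ρ s t ht)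
      have hcu := hu.continuous
      have : Continuous fun p : Euc n × Euc n => u p.1 - u (p.1 - p.2) := by fun_prop
      exact this.measurable.enorm

lemma IsTest.mul_right {n : ℕ} {φ f : Euc n → ℝ} (h : IsTest φ)
    (hf : ContDiff ℝ ((⊤ : ℕ∞) : WithTop ℕ∞) f) : IsTest (fun x => φ x * f x) :=
  ⟨h.1.mul hf, h.2.mul_right⟩

lemma IsTest.sub {n : ℕ} {φ f : Euc n → ℝ} (h : IsTest φ) (hf : IsTest f) : IsTest (φ - f) :=
  ⟨h.1.sub hf.1, h.2.sub hf.2⟩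

lemma pd_mul {n : ℕ} (i : Fin n) {f g : Euc n → ℝ} {x : Euc n} (hf : DifferentiableAt ℝ f x)
    (hg : DifferentiableAt ℝ g x) :
    pd i (fun x => f x * g x) x = f x * pd i g x + pd i f x * g x := by
  simp only [pd]
  rw [fderiv_fun_mul hf hg]
  simp [mul_comm]

lemma pd_sub {n : ℕ} (i : Fin n) {f g : Euc n → ℝ} {x : Euc n} (hf : DifferentiableAt ℝ f x)
    (hg : DifferentiableAt ℝ g x) :
    pd i (f - g) x = pd i f x - pd i g x := by
  simp only [pd]
  rw [fderiv_sub hf hg]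
  simp

lemma integral_mul_pd {n : ℕ} {φ f : Euc n → ℝ} (h : IsTest φ) (hf : IsTest f)
    (i : Fin n) : ∫ x, φ x * pd i f x = -∫ x, pd i φ x * f x := by
  refine integral_mul_fderiv_eq_neg_fderiv_mul_of_integrable
    (((h.pd i).mul_right hf.1).integrable) ((h.mul_right (hf.pd i).1).integrable)
    ((h.mul_right hf.1).integrable) (fun x _ => h.differentiable x)
    (fun x _ => hf.differentiable x)

lemma integral_pd_mul_pd_swap {n : ℕ} {φ f : Euc n → ℝ} (h : IsTest φ) (hf : IsTest f)
    (i j : Fin n) : ∫ x, pd j φ x * pd i f x = ∫ x, pd i φ x * pd j f x := by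
  have h1 := integral_mul_pd h (hf.pd i) j
  have h2 := integral_mul_pd h (hf.pd j) i
  rw [pd_comm j i hf.1] at h1
  linarith

/-- The trace-free Korn inequality for compactly supported smooth vector fields. -/
lemma integral_frobSq_jac_le {n : ℕ} (hn : 2 ≤ n) {w : Fin n → Euc n → ℝ}
    (hw : ∀ i, IsTest (w i)) :
    ∫ x, frobSq (jac w x) ≤ 2 * ∫ x, frobSq (tfSym (jac w x)) := by
  have hi : ∀ i j k l, Integrable fun x => pd j (w i) x * pd l (w k) x := fun i j k l =>
    (((hw i).pd j).mul_right ((hw k).pd l).1).integrable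
  have hfrob : Integrable fun x => frobSq (jac w x) := by
    simp only [frobSq, jac, pow_two]
    exact integrable_finsetSum _ fun i _ => integrable_finsetSum _ fun j _ => hi _ _ _ _
  have hcross : Integrable fun x => ∑ i, ∑ j, jac w x i j * jac w x j i :=
    integrable_finsetSum _ fun i _ => integrable_finsetSum _ fun j _ => hi _ _ _ _
  have htr : Integrable fun x => (∑ k, jac w x k k) ^ 2 := by
    simp only [pow_two, Finset.sum_mul_sum]
    exact integrable_finsetSum _ fun i _ => integrable_finsetSum _ fun j _ => hi _ _ _ _
  have hswap : ∫ x, ∑ i, ∑ j, jac w x i j * jac w x j i = ∫ x, (∑ k, jac w x k k) ^ 2 := by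
    simp only [pow_two, Finset.sum_mul_sum, jac]
    rw [integral_finsetSum _ fun i _ => integrable_finsetSum _ fun j _ => hi _ _ _ _,
      integral_finsetSum _ fun i _ => integrable_finsetSum _ fun j _ => hi _ _ _ _]
    refine Finset.sum_congr rfl fun i _ => ?_
    rw [integral_finsetSum _ fun j _ => hi _ _ _ _, integral_finsetSum _ fun j _ => hi _ _ _ _]
    exact Finset.sum_congr rfl fun j _ => integral_pd_mul_pd_swap (hw i) (hw j) i j
  simp only [frobSq_tfSym (by omega : n ≠ 0)]
  rw [integral_sub (f := fun x => frobSq (jac w x) / 2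
      + (∑ i, ∑ j, jac w x i j * jac w x j i) / 2)
      ((hfrob.div_const 2).add (hcross.div_const 2)) (htr.div_const _),
    integral_add (hfrob.div_const 2) (hcross.div_const 2), integral_div, integral_div,
    integral_div, hswap]
  have hT : 0 ≤ ∫ x, (∑ k, jac w x k k) ^ 2 := integral_nonneg fun x => sq_nonneg _
  have h2 : (∫ x, (∑ k, jac w x k k) ^ 2) / n ≤ (∫ x, (∑ k, jac w x k k) ^ 2) / 2 :=
    div_le_div_of_nonneg_left hT (by norm_num) (by exact_mod_cast hn)
  linarith

lemma continuous_frobSq {n : ℕ} : Continuous (frobSq : (Fin n → Fin n → ℝ) → ℝ) := by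
  unfold frobSq; fun_prop

lemma continuous_tfSym {n : ℕ} : Continuous (tfSym : (Fin n → Fin n → ℝ) → _) := by
  refine continuous_pi fun i => continuous_pi fun j => ?_
  unfold tfSym
  split_ifs <;> fun_prop

lemma continuous_jac {n : ℕ} {w : Fin n → Euc n → ℝ} (hw : ∀ i, IsTest (w i)) :
    Continuous (jac w) :=
  continuous_pi fun i => continuous_pi fun j => ((hw i).pd j).continuous

lemma frobSq_eq_zero {n : ℕ} : frobSq (0 : Fin n → Fin n → ℝ) = 0 := by simp [frobSq]

lemma tfSym_zero {n : ℕ} : tfSym (0 : Fin n → Fin n → ℝ) = 0 := by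
  ext i j; simp [tfSym]

lemma hasCompactSupport_jac {n : ℕ} {w : Fin n → Euc n → ℝ} (hw : ∀ i, IsTest (w i)) :
    HasCompactSupport (jac w) := by
  have hK : IsCompact (⋃ i, ⋃ j, tsupport (pd j (w i))) :=
    isCompact_iUnion fun i => isCompact_iUnion fun j => ((hw i).pd j).2
  refine HasCompactSupport.intro hK fun x hx => ?_
  ext i j
  simp only [mem_iUnion, not_exists] at hx
  exact image_eq_zero_of_notMem_tsupport (f := pd j (w i)) (hx i j)

lemma lintegral_frobSq_jac_le {n : ℕ} (hn : 2 ≤ n) {w : Fin n → Euc n → ℝ}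
    (hw : ∀ i, IsTest (w i)) :
    ∫⁻ x, ENNReal.ofReal (frobSq (jac w x)) ≤
      2 * ∫⁻ x, ENNReal.ofReal (frobSq (tfSym (jac w x))) := by
  have h1 : Integrable fun x => frobSq (jac w x) :=
    (continuous_frobSq.comp (continuous_jac hw)).integrable_of_hasCompactSupport
      ((hasCompactSupport_jac hw).comp_left frobSq_eq_zero)
  have h2 : Integrable fun x => frobSq (tfSym (jac w x)) :=
    (continuous_frobSq.comp (continuous_tfSym.comp
      (continuous_jac hw))).integrable_of_hasCompactSupport
      ((hasCompactSupport_jac hw).comp_left (g := fun P => frobSq (tfSym P))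
        (by rw [tfSym_zero, frobSq_eq_zero]))
  rw [← ofReal_integral_eq_lintegral_ofReal h1 (.of_forall fun x => frobSq_nonneg _),
    ← ofReal_integral_eq_lintegral_ofReal h2 (.of_forall fun x => frobSq_nonneg _)]
  refine (ENNReal.ofReal_le_ofReal (integral_frobSq_jac_le hn hw)).trans (le_of_eq ?_)
  rw [ENNReal.ofReal_mul (by norm_num), ENNReal.ofReal_ofNat]

lemma ofReal_frobSq {n : ℕ} (P : Fin n → Fin n → ℝ) :
    ENNReal.ofReal (frobSq P) = ∑ i, ∑ j, ‖P i j‖ₑ ^ 2 := by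
  simp only [frobSq, enorm_sq_eq_ofReal]
  rw [ENNReal.ofReal_sum_of_nonneg fun i _ => Finset.sum_nonneg fun _ _ => sq_nonneg _]
  exact Finset.sum_congr rfl fun i _ => ENNReal.ofReal_sum_of_nonneg fun j _ => sq_nonneg _

/-- Cutoff functions between concentric balls of radii `4 * R` and `5 * R`. -/
lemma exists_cutoff (n : ℕ) : ∃ C : ℝ, 0 < C ∧ ∀ (x₀ : Euc n) (R : ℝ), 0 < R →
    ∃ ζ : Euc n → ℝ, IsTest ζ ∧ (∀ x, 0 ≤ ζ x ∧ ζ x ≤ 1) ∧ (∀ x ∈ ball x₀ (4 * R), ζ x = 1) ∧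
      (∀ x, x ∉ ball x₀ (5 * R) → ζ x = 0 ∧ ∀ j, pd j ζ x = 0) ∧ ∀ j x, |pd j ζ x| ≤ C / R := by
  let b : ContDiffBump (0 : Euc n) := ⟨4, 9 / 2, by norm_num, by norm_num⟩
  have hb : IsTest (b : Euc n → ℝ) := ⟨b.contDiff, b.hasCompactSupport⟩
  choose C hC using fun j => (hb.pd j).bounded
  have hC0 : ∀ j, 0 ≤ C j := fun j => (abs_nonneg _).trans (hC j 0)
  refine ⟨1 + ∑ j, C j, add_pos_of_pos_of_nonneg one_pos (Finset.sum_nonneg fun j _ => hC0 j),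
    fun x₀ R hR => ?_⟩
  have hsup : ∀ x, x ∉ closedBall x₀ (9 / 2 * R) → b (R⁻¹ • (x - x₀)) = 0 := by
    intro x hx
    apply b.zero_of_le_dist
    simp only [mem_closedBall, not_le, dist_eq_norm] at hx
    simp only [dist_zero_right, norm_smul, norm_inv, Real.norm_eq_abs, abs_of_pos hR]
    rw [← div_eq_inv_mul]
    exact (le_div_iff₀ hR).2 hx.le
  have hpd : ∀ j x, pd j (fun x => b (R⁻¹ • (x - x₀))) x = R⁻¹ * pd j b (R⁻¹ • (x - x₀)) := by
    intro j x
    have h1 := congrFun (pd_comp_smul j hb.differentiable 1 R⁻¹) (x - x₀)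
    simp only [one_mul] at h1
    rw [← h1]
    simp only [pd]
    rw [fderiv_comp_sub (f := fun x => b (R⁻¹ • x))]
  have htest : IsTest fun x => b (R⁻¹ • (x - x₀)) :=
    ⟨b.contDiff.comp ((contDiff_id.sub contDiff_const).const_smul _),
      HasCompactSupport.intro (isCompact_closedBall _ _) hsup⟩
  refine ⟨fun x => b (R⁻¹ • (x - x₀)), htest, fun x => ⟨b.nonneg, b.le_one⟩, fun x hx => ?_,
    fun x hx => ?_, fun j x => ?_⟩
  · apply b.one_of_mem_closedBall
    simp only [mem_ball, dist_eq_norm] at hx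
    simp only [mem_closedBall, dist_zero_right, norm_smul, norm_inv, Real.norm_eq_abs,
      abs_of_pos hR]
    rw [← div_eq_inv_mul]
    exact (div_le_iff₀ hR).2 hx.le
  · have hx' : x ∉ closedBall x₀ (9 / 2 * R) := fun h => hx (closedBall_subset_ball
      (by linarith) h)
    refine ⟨hsup x hx', fun j => ?_⟩
    have : (fun x => b (R⁻¹ • (x - x₀))) =ᶠ[nhds x] fun _ => 0 := by
      filter_upwards [isClosed_closedBall.isOpen_compl.mem_nhds hx'] with y hy using hsup y hy
    simp only [pd]
    rw [this.fderiv_eq]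
    simp
  · rw [hpd, abs_mul, abs_inv, abs_of_pos hR, ← div_eq_inv_mul]
    refine div_le_div_of_nonneg_right ((hC j _).trans ?_) hR.le
    have := Finset.single_le_sum (f := C) (fun j _ => hC0 j) (Finset.mem_univ j)
    linarith

lemma IsTest.cv {n : ℕ} {φ f : Euc n → ℝ} (h : IsTest φ) (hf : IsTest f) : IsTest (cv φ f) :=
  ⟨contDiff_cv h hf.continuous.locallyIntegrable, hasCompactSupport_cv h.2 hf.2⟩

lemma tfSym_jac_cv {n : ℕ} {φ : Euc n → ℝ} (h : IsTest φ) {u : Fin n → Euc n → ℝ}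
    (hu : ∀ i, Differentiable ℝ (u i)) (hu' : ∀ i j, LocallyIntegrable (pd j (u i)))
    (x : Euc n) (i j : Fin n) :
    tfSym (jac (fun i => cv φ (u i)) x) i j = cv φ (fun y => tfSym (jac u y) i j) x := by
  have h1 : ∀ i j, pd j (cv φ (u i)) x = ∫ t, φ t * pd j (u i) (x - t) := fun i j => by
    rw [pd_cv h (hu i).continuous.locallyIntegrable, cv_pd h (hu i) j (hu' i j)]; rfl
  have hi : ∀ i j, Integrable fun t => φ t * pd j (u i) (x - t) := fun i j =>
    h.integrable_mul (hu' i j) x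
  simp only [tfSym, jac, h1, _root_.cv]
  by_cases hij : i = j
  · simp only [hij, if_true]
    rw [← integral_add (hi _ _) (hi _ _), ← integral_finsetSum _ fun k _ => hi _ _,
      ← integral_div, ← integral_div, ← integral_sub]
    · congr 1
      ext t
      rw [← Finset.mul_sum]
      ring
    · exact ((hi _ _).add (hi _ _)).div_const _
    · exact (integrable_finsetSum _ fun k _ => hi _ _).div_const _
  · simp only [hij, if_false, sub_zero]
    rw [← integral_add (hi _ _) (hi _ _), ← integral_div]
    congr 1
    ext t
    ring

lemma lintegral_frobSq {n : ℕ} {μ : Measure (Euc n)} {P : Euc n → Fin n → Fin n → ℝ}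
    (hP : ∀ i j, Measurable fun x => P x i j) :
    ∫⁻ x, ENNReal.ofReal (frobSq (P x)) ∂μ = ∑ i, ∑ j, ∫⁻ x, ‖P x i j‖ₑ ^ 2 ∂μ := by
  simp only [ofReal_frobSq]
  rw [lintegral_finsetSum _ fun i _ => Finset.measurable_sum _ fun j _ =>
    (hP i j).enorm.pow_const 2]
  exact Finset.sum_congr rfl fun i _ =>
    lintegral_finsetSum _ fun j _ => (hP i j).enorm.pow_const 2

lemma lintegral_frobSq_cv_le {n : ℕ} {φ : Euc n → ℝ} {s : ℝ} (h : IsMoll φ s)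
    {P : Euc n → Fin n → Fin n → ℝ} (hP : ∀ i j, Measurable fun x => P x i j)
    (hP' : ∀ i j, LocallyIntegrable fun x => P x i j) (x₀ : Euc n) (ρ : ℝ) :
    ∫⁻ x in ball x₀ ρ, ENNReal.ofReal (frobSq fun i j => cv φ (fun y => P y i j) x) ≤
      ∫⁻ x in ball x₀ (ρ + s), ENNReal.ofReal (frobSq (P x)) := by
  rw [lintegral_frobSq hP, lintegral_frobSq (P := fun x i j => cv φ (fun y => P y i j) x)
    fun i j => (contDiff_cv h.isTest (hP' i j)).continuous.measurable]
  exact Finset.sum_le_sum fun i _ => Finset.sum_le_sum fun j _ =>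
    lintegral_cv_sq_le h (hP i j) x₀ ρ

/-- Caccioppoli-type inequality for the trace-free symmetric gradient. -/
lemma exists_caccioppoli {n : ℕ} (hn : 2 ≤ n) : ∃ C : ℝ, 0 < C ∧
    ∀ (x₀ : Euc n) (R : ℝ), 0 < R → ∀ h : Fin n → Euc n → ℝ, (∀ i, IsTest (h i)) →
    ∫⁻ x in ball x₀ (4 * R), ENNReal.ofReal (frobSq (jac h x)) ≤
      4 * (∫⁻ x in ball x₀ (5 * R), ENNReal.ofReal (frobSq (tfSym (jac h x)))) +
      ENNReal.ofReal (C / R ^ 2) * ∫⁻ x in ball x₀ (5 * R), ENNReal.ofReal (∑ i, h i x ^ 2) := by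
  obtain ⟨C, hC, hcut⟩ := exists_cutoff n
  refine ⟨4 * n * C ^ 2, by positivity, fun x₀ R hR h hh => ?_⟩
  obtain ⟨ζ, hζ, hζ01, hζ1, hζ0, hζd⟩ := hcut x₀ R hR
  set w : Fin n → Euc n → ℝ := fun i x => ζ x * h i x with hw
  have hwt : ∀ i, IsTest (w i) := fun i => hζ.mul_right (hh i).1
  have hjac : ∀ x, jac w x = ζ x • jac h x + fun i j => pd j ζ x * h i x := by
    intro x
    ext i j
    exact pd_mul j (hζ.differentiable x) ((hh i).differentiable x)
  have hpt : ∀ x, frobSq (tfSym (jac w x)) ≤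
      2 * frobSq (tfSym (jac h x)) + 2 * n * C ^ 2 / R ^ 2 * ∑ i, h i x ^ 2 := by
    intro x
    rw [hjac, tfSym_add, tfSym_smul]
    refine (frobSq_add_le _ _).trans ?_
    rw [frobSq_smul]
    have h1 : ζ x ^ 2 ≤ 1 := pow_le_one₀ (hζ01 x).1 (hζ01 x).2
    have h2 := frobSq_tfSym_le fun i j => pd j ζ x * h i x
    have h3 : (frobSq fun i j => pd j ζ x * h i x) ≤ n * (C / R) ^ 2 * ∑ i, h i x ^ 2 := by
      simp only [frobSq, mul_pow, ← Finset.sum_mul, Finset.mul_sum]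
      refine Finset.sum_le_sum fun i _ => mul_le_mul_of_nonneg_right ?_ (sq_nonneg _)
      have : ∀ j, pd j ζ x ^ 2 ≤ (C / R) ^ 2 := fun j => by
        rw [← sq_abs]; exact pow_le_pow_left₀ (abs_nonneg _) (hζd j x) 2
      simpa using Finset.sum_le_card_nsmul Finset.univ _ _ fun j _ => this j
    have h4 := mul_le_mul_of_nonneg_right h1 (frobSq_nonneg (tfSym (jac h x)))
    have h5 : 2 * n * C ^ 2 / R ^ 2 * ∑ i, h i x ^ 2
      = 2 * (n * (C / R) ^ 2 * ∑ i, h i x ^ 2) := by ring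
    rw [h5]
    linarith
  have hout : ∀ x, x ∉ ball x₀ (5 * R) → tfSym (jac w x) = 0 := by
    intro x hx
    rw [hjac]
    have h0 := hζ0 x hx
    simp only [h0.1, h0.2, zero_smul, zero_mul, zero_add]
    exact tfSym_zero
  have hin : ∀ x ∈ ball x₀ (4 * R), jac w x = jac h x := by
    intro x hx
    ext i j
    have : w i =ᶠ[nhds x] h i := by
      filter_upwards [isOpen_ball.mem_nhds hx] with y hy
      simp [hw, hζ1 y hy]
    simp only [jac, pd]
    rw [this.fderiv_eq]
  calc ∫⁻ x in ball x₀ (4 * R), ENNReal.ofReal (frobSq (jac h x))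
      = ∫⁻ x in ball x₀ (4 * R), ENNReal.ofReal (frobSq (jac w x)) :=
        setLIntegral_congr_fun measurableSet_ball fun x hx => by simp only [hin x hx]
    _ ≤ ∫⁻ x, ENNReal.ofReal (frobSq (jac w x)) := setLIntegral_le_lintegral _ _
    _ ≤ 2 * ∫⁻ x, ENNReal.ofReal (frobSq (tfSym (jac w x))) := lintegral_frobSq_jac_le hn hwt
    _ = 2 * ∫⁻ x in ball x₀ (5 * R), ENNReal.ofReal (frobSq (tfSym (jac w x))) := by
        rw [setLIntegral_eq_of_support_subset]
        intro x hx
        by_contra hc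
        exact hx (by simp only [hout x hc, frobSq_eq_zero, ENNReal.ofReal_zero])
    _ ≤ 2 * ∫⁻ x in ball x₀ (5 * R), (2 * ENNReal.ofReal (frobSq (tfSym (jac h x))) +
          ENNReal.ofReal (2 * n * C ^ 2 / R ^ 2) * ENNReal.ofReal (∑ i, h i x ^ 2)) := by
        gcongr with x
        refine (ENNReal.ofReal_le_ofReal (hpt x)).trans (le_of_eq ?_)
        have := frobSq_nonneg (tfSym (jac h x))
        have : 0 ≤ ∑ i, h i x ^ 2 := Finset.sum_nonneg fun _ _ => sq_nonneg _
        rw [ENNReal.ofReal_add (by positivity) (by positivity), ENNReal.ofReal_mul (by norm_num),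
          ENNReal.ofReal_mul (by positivity), ENNReal.ofReal_ofNat]
    _ = _ := by
        have hm1 : Measurable fun x => ENNReal.ofReal (frobSq (tfSym (jac h x))) :=
          (continuous_frobSq.comp (continuous_tfSym.comp
            (continuous_jac hh))).measurable.ennreal_ofReal
        have hm2 : Measurable fun x => ENNReal.ofReal (∑ i, h i x ^ 2) :=
          (continuous_finsetSum _ fun i _ =>
            (hh i).continuous.pow 2).measurable.ennreal_ofReal
        rw [lintegral_add_left (hm1.const_mul _), lintegral_const_mul _ hm1,
          lintegral_const_mul _ hm2, mul_add, ← mul_assoc, ← mul_assoc]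
        congr 2
        · norm_num
        · conv_lhs => rw [← ENNReal.ofReal_ofNat 2, ← ENNReal.ofReal_mul (by norm_num)]
          congr 1
          ring

lemma exists_local_smooth {n : ℕ} (hn : 2 ≤ n) : ∃ C : ℝ, 0 < C ∧
    ∀ (x₀ : Euc n) (R s : ℝ), 0 < R → s ≤ R → ∀ φ : Euc n → ℝ, IsMoll φ s →
    ∀ u : Fin n → Euc n → ℝ, (∀ i, IsTest (u i)) →
    ∫⁻ x in ball x₀ (4 * R), ENNReal.ofReal (frobSq (jac (fun i => u i - cv φ (u i)) x)) ≤
      16 * (∫⁻ x in ball x₀ (6 * R), ENNReal.ofReal (frobSq (tfSym (jac u x)))) +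
      ENNReal.ofReal (C * (s / R) ^ 2) *
        ∫⁻ x in ball x₀ (6 * R), ENNReal.ofReal (frobSq (jac u x)) := by
  obtain ⟨C, hC, hcac⟩ := exists_caccioppoli hn
  refine ⟨C, hC, fun x₀ R s hR hsR φ hφ u hu => ?_⟩
  have hsub : ball x₀ (5 * R + s) ⊆ ball x₀ (6 * R) := ball_subset_ball (by linarith)
  have hg : ∀ i, IsTest (cv φ (u i)) := fun i => hφ.isTest.cv (hu i)
  have hl : ∀ i j, LocallyIntegrable (pd j (u i)) := fun i j =>
    ((hu i).pd j).continuous.locallyIntegrable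
  have htc : Continuous fun x => tfSym (jac u x) := continuous_tfSym.comp (continuous_jac hu)
  have hti : ∀ i j, Continuous fun x => tfSym (jac u x) i j := fun i j =>
    (continuous_apply j).comp ((continuous_apply i).comp htc)
  have hm : Measurable fun x => ENNReal.ofReal (frobSq (tfSym (jac u x))) :=
    (continuous_frobSq.comp htc).measurable.ennreal_ofReal
  have h1 : ∫⁻ x in ball x₀ (5 * R),
      ENNReal.ofReal (frobSq (tfSym (jac (fun i => u i - cv φ (u i)) x))) ≤
      4 * ∫⁻ x in ball x₀ (6 * R), ENNReal.ofReal (frobSq (tfSym (jac u x))) := by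
    have hcv := lintegral_frobSq_cv_le hφ (P := fun x => tfSym (jac u x))
      (fun i j => (hti i j).measurable) (fun i j => (hti i j).locallyIntegrable) x₀ (5 * R)
    have hpt : ∀ x, frobSq (tfSym (jac (fun i => u i - cv φ (u i)) x)) ≤
        2 * frobSq (tfSym (jac u x)) +
        2 * frobSq (fun i j => cv φ (fun y => tfSym (jac u y) i j) x) := by
      intro x
      have e1 : jac (fun i => u i - cv φ (u i)) x = jac u x - jac (fun i => cv φ (u i)) x := by
        ext i j
        exact pd_sub j ((hu i).differentiable x) ((hg i).differentiable x)
      have e2 : tfSym (jac (fun i => cv φ (u i)) x) =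
          fun i j => cv φ (fun y => tfSym (jac u y) i j) x := by
        ext i j
        exact tfSym_jac_cv hφ.isTest (fun i => (hu i).differentiable) hl x i j
      rw [e1, tfSym_sub, e2]
      exact frobSq_sub_le _ _
    calc _ ≤ ∫⁻ x in ball x₀ (5 * R), (2 * ENNReal.ofReal (frobSq (tfSym (jac u x))) +
          2 * ENNReal.ofReal (frobSq (fun i j => cv φ (fun y => tfSym (jac u y) i j) x))) := by
          gcongr with x
          refine (ENNReal.ofReal_le_ofReal (hpt x)).trans (le_of_eq ?_)
          have := frobSq_nonneg (tfSym (jac u x))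
          have := frobSq_nonneg (fun i j => cv φ (fun y => tfSym (jac u y) i j) x)
          rw [ENNReal.ofReal_add (by positivity) (by positivity),
            ENNReal.ofReal_mul (by norm_num), ENNReal.ofReal_mul (by norm_num),
            ENNReal.ofReal_ofNat]
      _ = 2 * (∫⁻ x in ball x₀ (5 * R), ENNReal.ofReal (frobSq (tfSym (jac u x)))) +
          2 * ∫⁻ x in ball x₀ (5 * R),
            ENNReal.ofReal (frobSq (fun i j => cv φ (fun y => tfSym (jac u y) i j) x)) := by
          rw [lintegral_add_left (hm.const_mul _), lintegral_const_mul _ hm,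
            lintegral_const_mul' _ _ (by simp)]
      _ ≤ 2 * (∫⁻ x in ball x₀ (6 * R), ENNReal.ofReal (frobSq (tfSym (jac u x)))) +
          2 * ∫⁻ x in ball x₀ (6 * R), ENNReal.ofReal (frobSq (tfSym (jac u x))) := by
          gcongr 2 * ?_ + 2 * ?_
          · exact lintegral_mono_set (ball_subset_ball (by linarith))
          · exact hcv.trans (lintegral_mono_set hsub)
      _ = _ := by rw [← add_mul]; norm_num
  have h2 : ∫⁻ x in ball x₀ (5 * R), ENNReal.ofReal (∑ i, (u i - cv φ (u i)) x ^ 2) ≤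
      ENNReal.ofReal (s ^ 2) * ∫⁻ x in ball x₀ (6 * R), ENNReal.ofReal (frobSq (jac u x)) := by
    have hc : ∀ i, Continuous fun x => u i x - cv φ (u i) x := fun i =>
      (hu i).continuous.sub (hg i).continuous
    have hcd : ∀ i, Continuous fun x => ∑ j, pd j (u i) x ^ 2 := fun i =>
      continuous_finsetSum _ fun j _ => ((hu i).pd j).continuous.pow 2
    calc _ = ∑ i, ∫⁻ x in ball x₀ (5 * R), ‖u i x - cv φ (u i) x‖ₑ ^ 2 := by
          rw [← lintegral_finsetSum _ fun i _ => (hc i).measurable.enorm.pow_const 2]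
          congr 1
          ext x
          rw [ENNReal.ofReal_sum_of_nonneg fun i _ => sq_nonneg _]
          exact Finset.sum_congr rfl fun i _ => (enorm_sq_eq_ofReal _).symm
      _ ≤ ∑ i, ∫⁻ x in ball x₀ (6 * R), ENNReal.ofReal (s ^ 2 * ∑ j, pd j (u i) x ^ 2) :=
          Finset.sum_le_sum fun i _ => (lintegral_sub_cv_sq_le hφ ((hu i).1.of_le (by simp))
            x₀ (5 * R)).trans (lintegral_mono_set hsub)
      _ = _ := by
          rw [← lintegral_finsetSum _ fun i _ =>
            ((hcd i).measurable.const_mul _).ennreal_ofReal,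
            ← lintegral_const_mul' _ _ ENNReal.ofReal_ne_top]
          congr 1
          ext x
          rw [← ENNReal.ofReal_sum_of_nonneg fun i _ => mul_nonneg (sq_nonneg _)
            (Finset.sum_nonneg fun _ _ => sq_nonneg _), ← Finset.mul_sum,
            ENNReal.ofReal_mul (sq_nonneg s)]
          rfl
  refine (hcac x₀ R hR _ fun i => (hu i).sub (hg i)).trans ?_
  refine (add_le_add (mul_le_mul_right h1 _) (mul_le_mul_right h2 _)).trans (le_of_eq ?_)
  rw [← mul_assoc, ← mul_assoc, ← ENNReal.ofReal_mul (by positivity)]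
  congr 2
  · norm_num
  · congr 1
    field_simp

lemma isMoll_normed {n : ℕ} (b : ContDiffBump (0 : Euc n)) : IsMoll (b.normed volume) b.rOut := by
  refine ⟨b.contDiff_normed, b.nonneg_normed, b.integral_normed, fun x hx => ?_⟩
  have : x ∉ Function.support (b.normed (volume : Measure (Euc n))) := by
    rw [b.support_normed_eq]
    simpa using hx.le
  simpa using this

lemma tendsto_cv_cv_normed {n : ℕ} {ψ f : Euc n → ℝ} (hψ : IsTest ψ) (hf : Continuous f)
    (hf' : HasCompactSupport f) {b : ℕ → ContDiffBump (0 : Euc n)}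
    (hb : Filter.Tendsto (fun k => (b k).rOut) Filter.atTop (nhds 0)) (x : Euc n) :
    Filter.Tendsto (fun k => cv ψ (cv ((b k).normed volume) f) x) Filter.atTop
      (nhds (cv ψ f x)) := by
  have huc : UniformContinuous f := hf.uniformContinuous_of_tendsto_cocompact hf'.is_zero_at_infty
  set A := ∫ t, |ψ t| with hA
  have hA0 : 0 ≤ A := integral_nonneg fun t => abs_nonneg _
  rw [Metric.tendsto_nhds]
  intro ε hε
  obtain ⟨δ, hδ, hδf⟩ := Metric.uniformContinuous_iff.1 huc (ε / (A + 1)) (by positivity)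
  filter_upwards [hb.eventually (gt_mem_nhds hδ)] with k hk
  have hclose : ∀ y, |cv ((b k).normed volume) f y - f y| ≤ ε / (A + 1) := fun y =>
    (b k).dist_normed_convolution_le (μ := volume) (x₀ := y) (g := f) hf.aestronglyMeasurable
      fun z hz => (hδf ((mem_ball.1 hz).trans hk)).le
  have hbk := (isMoll_normed (b k)).isTest
  have h1 := hψ.integrable_mul (contDiff_cv hbk hf.locallyIntegrable).continuous.locallyIntegrable x
  have h2 := hψ.integrable_mul hf.locallyIntegrable x
  rw [Real.dist_eq]
  calc |cv ψ (cv ((b k).normed volume) f) x - cv ψ f x|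
      = |∫ t, ψ t * (cv ((b k).normed volume) f (x - t) - f (x - t))| := by
        simp only [mul_sub]
        rw [integral_sub h1 h2]; rfl
    _ ≤ ∫ t, |ψ t| * (ε / (A + 1)) := by
        rw [← Real.norm_eq_abs]
        refine norm_integral_le_of_norm_le (hψ.integrable.abs.mul_const _) (.of_forall fun t => ?_)
        rw [Real.norm_eq_abs, abs_mul]
        exact mul_le_mul_of_nonneg_left (hclose _) (abs_nonneg _)
    _ = A * (ε / (A + 1)) := integral_mul_const _ _
    _ < ε := by
        rw [mul_div_assoc', div_lt_iff₀ (by positivity)]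
        nlinarith

lemma measurable_pd {n : ℕ} (i : Fin n) (f : Euc n → ℝ) : Measurable (pd i f) :=
  measurable_fderiv_apply_const ℝ f _

lemma measurable_tfSym {n : ℕ} {P : Euc n → Fin n → Fin n → ℝ}
    (hP : ∀ i j, Measurable fun x => P x i j) (i j : Fin n) :
    Measurable fun x => tfSym (P x) i j := by
  have : Measurable P := measurable_pi_lambda _ fun i => measurable_pi_lambda _ fun j => hP i j
  exact ((measurable_pi_apply j).comp ((measurable_pi_apply i).comp
    (continuous_tfSym.measurable.comp this)))

lemma locallyIntegrable_tfSym {n : ℕ} {P : Euc n → Fin n → Fin n → ℝ}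
    (hP : ∀ i j, LocallyIntegrable fun x => P x i j) (i j : Fin n) :
    LocallyIntegrable fun x => tfSym (P x) i j := by
  have h1 : LocallyIntegrable fun x => (P x i j + P x j i) / 2 := by
    have := ((hP i j).add (hP j i)).smul (2⁻¹ : ℝ)
    simp only [div_eq_inv_mul]
    exact this
  by_cases h : i = j
  · have h2 : LocallyIntegrable fun x => (∑ k, P x k k) / (n : ℝ) := by
      have := (locallyIntegrable_finsetSum Finset.univ
        fun k _ => hP k k).smul ((n : ℝ)⁻¹)
      simpa [div_eq_inv_mul, Pi.smul_def] using this
    have h3 : LocallyIntegrable fun x => (P x i j + P x j i) / 2 - (∑ k, P x k k) / (n : ℝ) :=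
      h1.sub h2
    subst h
    simpa only [tfSym, if_true] using h3
  · simpa [tfSym, h] using h1

lemma exists_local_compactSupport {n : ℕ} (hn : 2 ≤ n) : ∃ C : ℝ, 0 < C ∧
    ∀ (x₀ : Euc n) (R s : ℝ), 0 < R → s ≤ R → ∀ φ : Euc n → ℝ, IsMoll φ s →
    ∀ u : Fin n → Euc n → ℝ, (∀ i, Differentiable ℝ (u i)) → (∀ i, HasCompactSupport (u i)) →
    (∀ i j, LocallyIntegrable (pd j (u i))) →
    ∫⁻ x in ball x₀ (4 * R), ENNReal.ofReal (frobSq (jac (fun i => u i - cv φ (u i)) x)) ≤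
      16 * (∫⁻ x in ball x₀ (7 * R), ENNReal.ofReal (frobSq (tfSym (jac u x)))) +
      ENNReal.ofReal (C * (s / R) ^ 2) *
        ∫⁻ x in ball x₀ (7 * R), ENNReal.ofReal (frobSq (jac u x)) := by
  obtain ⟨C, hC, hsm⟩ := exists_local_smooth hn
  refine ⟨C, hC, fun x₀ R s hR hsR φ hφ u hu hc hl => ?_⟩
  let b : ℕ → ContDiffBump (0 : Euc n) := fun k =>
    ⟨R / (k + 1) / 2, R / (k + 1), by positivity, half_lt_self (by positivity)⟩
  have hbout : Filter.Tendsto (fun k => (b k).rOut) Filter.atTop (nhds 0) := by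
    have := (tendsto_one_div_add_atTop_nhds_zero_nat (𝕜 := ℝ)).const_mul R
    simpa [b, div_eq_mul_inv] using this
  have hbR : ∀ k, (b k).rOut ≤ R := fun k => by
    refine div_le_self hR.le ?_
    have := Nat.cast_nonneg (α := ℝ) k
    linarith
  set β : ℕ → Euc n → ℝ := fun k => (b k).normed volume with hβ
  have hβm : ∀ k, IsMoll (β k) (b k).rOut := fun k => isMoll_normed (b k)
  set U : ℕ → Fin n → Euc n → ℝ := fun k i => cv (β k) (u i) with hU
  have hul : ∀ i, LocallyIntegrable (u i) := fun i => (hu i).continuous.locallyIntegrable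
  have hUt : ∀ k i, IsTest (U k i) := fun k i =>
    ⟨contDiff_cv (hβm k).isTest (hul i), hasCompactSupport_cv (hβm k).isTest.2 (hc i)⟩
  have hUd : ∀ k, jac (U k) = fun x i j => cv (β k) (fun y => jac u y i j) x := by
    intro k
    ext x i j
    simp only [jac, hU]
    rw [pd_cv (hβm k).isTest (hul i), cv_pd (hβm k).isTest (hu i) j (hl i j)]
  have hUtf : ∀ k x, tfSym (jac (U k) x) = fun i j => cv (β k) (fun y => tfSym (jac u y) i j) x :=
    fun k x => by ext i j; exact tfSym_jac_cv (hβm k).isTest hu hl x i j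
  have hm : ∀ i j, Measurable fun x => jac u x i j := fun i j => measurable_pd j (u i)
  have hk : ∀ k, ∫⁻ x in ball x₀ (4 * R),
      ENNReal.ofReal (frobSq (jac (fun i => U k i - cv φ (U k i)) x)) ≤
      16 * (∫⁻ x in ball x₀ (7 * R), ENNReal.ofReal (frobSq (tfSym (jac u x)))) +
      ENNReal.ofReal (C * (s / R) ^ 2) *
        ∫⁻ x in ball x₀ (7 * R), ENNReal.ofReal (frobSq (jac u x)) := by
    intro k
    have hsub : ball x₀ (6 * R + (b k).rOut) ⊆ ball x₀ (7 * R) :=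
      ball_subset_ball (by linarith [hbR k])
    refine (hsm x₀ R s hR hsR φ hφ (U k) (hUt k)).trans ?_
    gcongr 16 * ?_ + _ * ?_
    · simp only [hUtf]
      exact (lintegral_frobSq_cv_le (hβm k) (measurable_tfSym hm)
        (locallyIntegrable_tfSym hl) _ _).trans (lintegral_mono_set hsub)
    · simp only [hUd]
      exact (lintegral_frobSq_cv_le (hβm k) hm hl _ _).trans (lintegral_mono_set hsub)
  have hae : ∀ᵐ x, Filter.Tendsto (fun k => ENNReal.ofReal
      (frobSq (jac (fun i => U k i - cv φ (U k i)) x))) Filter.atTop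
      (nhds (ENNReal.ofReal (frobSq (jac (fun i => u i - cv φ (u i)) x)))) := by
    have h1 : ∀ᵐ x, ∀ i j, Filter.Tendsto (fun k => cv (β k) (pd j (u i)) x) Filter.atTop
        (nhds (pd j (u i) x)) :=
      ae_all_iff.2 fun i => ae_all_iff.2 fun j =>
        ContDiffBump.ae_convolution_tendsto_right_of_locallyIntegrable (K := 2) hbout
          (.of_forall fun k => (mul_div_cancel₀ (R / ((k : ℝ) + 1)) two_ne_zero).ge) (hl i j)
    filter_upwards [h1] with x hx
    refine (ENNReal.continuous_ofReal.tendsto _).comp ((continuous_frobSq.tendsto _).comp ?_)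
    refine tendsto_pi_nhds.2 fun i => tendsto_pi_nhds.2 fun j => ?_
    have e1 : ∀ k, pd j (U k i - cv φ (U k i)) x =
        cv (β k) (pd j (u i)) x - cv (pd j φ) (cv (β k) (u i)) x := fun k => by
      rw [pd_sub j ((hUt k i).differentiable x) ((hφ.isTest.cv (hUt k i)).differentiable x),
        pd_cv hφ.isTest (hUt k i).continuous.locallyIntegrable]
      congr 1
      exact congrFun (congrFun (congrFun (hUd k) x) i) j
    have e2 : pd j (u i - cv φ (u i)) x = pd j (u i) x - cv (pd j φ) (u i) x := by
      rw [pd_sub j (hu i x) ((contDiff_cv hφ.isTest (hul i)).differentiable (by simp) x),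
        pd_cv hφ.isTest (hul i)]
    simp only [jac, e1, e2]
    exact (hx i j).sub (tendsto_cv_cv_normed (hφ.isTest.pd j) (hu i).continuous (hc i) hbout x)
  calc ∫⁻ x in ball x₀ (4 * R), ENNReal.ofReal (frobSq (jac (fun i => u i - cv φ (u i)) x))
      = ∫⁻ x in ball x₀ (4 * R), Filter.liminf (fun k => ENNReal.ofReal
          (frobSq (jac (fun i => U k i - cv φ (U k i)) x))) Filter.atTop :=
        lintegral_congr_ae (ae_restrict_of_ae (hae.mono fun x hx => hx.liminf_eq.symm))
    _ ≤ Filter.liminf (fun k => ∫⁻ x in ball x₀ (4 * R), ENNReal.ofReal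
          (frobSq (jac (fun i => U k i - cv φ (U k i)) x))) Filter.atTop :=
        lintegral_liminf_le fun k => (continuous_frobSq.comp (continuous_jac fun i =>
          (hUt k i).sub (hφ.isTest.cv (hUt k i)))).measurable.ennreal_ofReal
    _ ≤ _ := Filter.liminf_le_of_frequently_le' (Filter.Frequently.of_forall hk)

/-- The third derivatives of a vector field are determined by the second derivatives of its
trace-free symmetric gradient. -/
lemma abs_thirdDeriv_le {n : ℕ} (hn : 3 ≤ n) (T : Fin n → Fin n → Fin n → Fin n → ℝ)
    (h12 : ∀ a b c k, T a b c k = T b a c k) (h23 : ∀ a b c k, T a b c k = T a c b k) {M : ℝ}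
    (hM : ∀ a b i j, |tfSym (fun i j => T a b j i) i j| ≤ M) (a b c k : Fin n) :
    |T a b c k| ≤ 21 * M := by
  set Θ : Fin n → Fin n → ℝ := fun a b => (∑ k, T a b k k) / n with hΘ
  set L : Fin n → Fin n → Fin n → Fin n → ℝ := fun a b => tfSym (fun i j => T a b j i) with hL
  have hLd : ∀ a b i, L a b i i = T a b i i - Θ a b := fun a b i => by
    simp [hL, tfSym, hΘ]
  have hLo : ∀ a b i j, i ≠ j → L a b i j = (T a b j i + T a b i j) / 2 := fun a b i j h => by
    simp [hL, tfSym, h]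
  have hM' : ∀ a b i j, -M ≤ L a b i j ∧ L a b i j ≤ M := fun a b i j => abs_le.1 (hM a b i j)
  have hM0 : 0 ≤ M := (abs_nonneg _).trans (hM a a a a)
  have hpair : ∀ i j, i ≠ j → Θ i i + Θ j j = 2 * L i j i j - L i i j j - L j j i i := by
    intro i j hij
    rw [hLd, hLd, hLo _ _ _ _ hij, h23 i j i j, h12 i j j i, h23 j i j i]
    ring
  have hthird : ∀ i j : Fin n, ∃ k, k ≠ i ∧ k ≠ j := by
    intro i j
    obtain ⟨k, hk⟩ := Finset.exists_mem_notMem_of_card_lt_card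
      (s := ({i, j} : Finset (Fin n))) (t := Finset.univ)
      (lt_of_le_of_lt Finset.card_le_two (by rw [Finset.card_univ, Fintype.card_fin]; omega))
    refine ⟨k, ?_⟩
    simpa using hk.2
  have hdiag : ∀ i, |Θ i i| ≤ 6 * M := by
    intro i
    obtain ⟨j, hj, -⟩ := hthird i i
    obtain ⟨k, hki, hkj⟩ := hthird i j
    have h1 := hpair i j hj.symm
    have h2 := hpair i k hki.symm
    have h3 := hpair j k hkj.symm
    rw [abs_le]
    constructor <;>
    linarith [(hM' i j i j).1, (hM' i j i j).2, (hM' i i j j).1, (hM' i i j j).2,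
      (hM' j j i i).1, (hM' j j i i).2, (hM' i k i k).1, (hM' i k i k).2, (hM' i i k k).1,
      (hM' i i k k).2, (hM' k k i i).1, (hM' k k i i).2, (hM' j k j k).1, (hM' j k j k).2,
      (hM' j j k k).1, (hM' j j k k).2, (hM' k k j j).1, (hM' k k j j).2]
  have hoff : ∀ i j, i ≠ j → |Θ i j| ≤ 6 * M := by
    intro i j hij
    obtain ⟨k, hki, hkj⟩ := hthird i j
    have h1 : Θ i j = L i k j k + L j k i k - L i j k k - L k k i j := by
      rw [hLd, hLo _ _ _ _ hkj.symm, hLo _ _ _ _ hki.symm, hLo _ _ _ _ hij,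
        h12 k k j i, h23 k k j i, h12 k j k i, h23 i k j k, h23 j k i k, h12 j i k k,
        h23 k k i j, h12 k i k j]
      ring
    rw [abs_le]
    constructor <;>
    linarith [(hM' i k j k).1, (hM' i k j k).2, (hM' j k i k).1, (hM' j k i k).2,
      (hM' i j k k).1, (hM' i j k k).2, (hM' k k i j).1, (hM' k k i j).2]
  have hE : ∀ a b i j, |(T a b j i + T a b i j) / 2| ≤ 7 * M := by
    intro a b i j
    have hΘM : |Θ a b| ≤ 6 * M := by
      by_cases hab : a = b
      · subst hab; exact hdiag a
      · exact hoff a b hab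
    have h1 := abs_le.1 hΘM
    have h2 := hM' a b i j
    by_cases hij : i = j
    · subst hij
      rw [hLd] at h2
      rw [abs_le]
      constructor <;> linarith
    · rw [hLo _ _ _ _ hij] at h2
      rw [abs_le]
      constructor <;> linarith
  have h1 := abs_le.1 (hE a b c k)
  have h2 := abs_le.1 (hE a c b k)
  have h3 := abs_le.1 (hE a k b c)
  have e1 : T a c b k = T a b c k := h23 _ _ _ _
  have e2 : T a k b c = T a b k c := h23 _ _ _ _
  have e3 : T a k c b = T a c k b := h23 _ _ _ _
  rw [abs_le]
  constructor <;> linarith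

lemma sq_lintegral_le_mul {T : Type*} [MeasurableSpace T] (ν : Measure T)
    {F : T → ℝ≥0∞} (hF : AEMeasurable F ν) : (∫⁻ t, F t ∂ν) ^ 2 ≤ ν univ * ∫⁻ t, F t ^ 2 ∂ν := by
  have h := ENNReal.lintegral_mul_le_Lp_mul_Lq ν Real.HolderConjugate.two_two hF
    (aemeasurable_const (b := (1 : ℝ≥0∞)))
  simp only [Pi.mul_apply, mul_one, ENNReal.one_rpow, lintegral_const, one_mul] at h
  have h2 := pow_le_pow_left' h 2
  refine h2.trans (le_of_eq ?_)
  rw [mul_pow, mul_comm, ← ENNReal.rpow_natCast, ← ENNReal.rpow_natCast, ← ENNReal.rpow_mul,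
    ← ENNReal.rpow_mul]
  norm_num

lemma pd_eq_zero_of_norm {n : ℕ} {f : Euc n → ℝ} {s : ℝ} (hf : ∀ x, s < ‖x‖ → f x = 0)
    (i : Fin n) (x : Euc n) (hx : s < ‖x‖) : pd i f x = 0 := by
  have : f =ᶠ[nhds x] fun _ => 0 := by
    filter_upwards [(isOpen_lt continuous_const continuous_norm).mem_nhds hx] with y hy
      using hf y hy
  simp only [pd]
  rw [this.fderiv_eq]
  simp

lemma enorm_cv_sq_le {n : ℕ} {ψ f : Euc n → ℝ} {s K : ℝ}
    (hψ0 : ∀ x, s < ‖x‖ → ψ x = 0) (hψK : ∀ x, |ψ x| ≤ K) (hf : Measurable f) (x : Euc n) :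
    ‖cv ψ f x‖ₑ ^ 2 ≤ ENNReal.ofReal (K ^ 2) * volume (closedBall (0 : Euc n) s) *
      ∫⁻ y in closedBall x s, ‖f y‖ₑ ^ 2 := by
  have hK : 0 ≤ K := (abs_nonneg _).trans (hψK 0)
  have h1 : ‖cv ψ f x‖ₑ ≤ ENNReal.ofReal K * ∫⁻ t in closedBall 0 s, ‖f (x - t)‖ₑ := by
    refine (enorm_integral_le_lintegral_enorm _).trans ?_
    rw [← lintegral_const_mul' _ _ ENNReal.ofReal_ne_top,
      ← lintegral_indicator measurableSet_closedBall]
    refine lintegral_mono fun t => ?_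
    by_cases ht : t ∈ closedBall (0 : Euc n) s
    · rw [indicator_of_mem ht, enorm_mul]
      gcongr
      rw [Real.enorm_eq_ofReal_abs]
      exact ENNReal.ofReal_le_ofReal (hψK t)
    · rw [hψ0 t (by simpa using ht)]
      simp
  have hm : Measurable fun t => ‖f (x - t)‖ₑ := (hf.comp (measurable_const.sub measurable_id)).enorm
  have h2 := sq_lintegral_le_mul (volume.restrict (closedBall (0 : Euc n) s)) hm.aemeasurable
  rw [Measure.restrict_apply_univ] at h2
  have h3 : ∫⁻ t in closedBall (0 : Euc n) s, ‖f (x - t)‖ₑ ^ 2 =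
      ∫⁻ y in closedBall x s, ‖f y‖ₑ ^ 2 := by
    rw [← lintegral_indicator measurableSet_closedBall,
      ← lintegral_indicator measurableSet_closedBall,
      ← lintegral_sub_left_eq_self ((closedBall x s).indicator fun y => ‖f y‖ₑ ^ 2) x]
    congr 1
    ext t
    by_cases ht : t ∈ closedBall (0 : Euc n) s
    · have : x - t ∈ closedBall x s := by simpa [dist_eq_norm] using ht
      rw [indicator_of_mem ht, indicator_of_mem this]
    · have : x - t ∉ closedBall x s := by simpa [dist_eq_norm] using ht
      rw [indicator_of_notMem ht, indicator_of_notMem this]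
  calc ‖cv ψ f x‖ₑ ^ 2 ≤ (ENNReal.ofReal K * ∫⁻ t in closedBall 0 s, ‖f (x - t)‖ₑ) ^ 2 :=
        pow_le_pow_left' h1 2
    _ ≤ _ := by
        rw [mul_pow, ← ENNReal.ofReal_pow hK, mul_assoc, ← h3]
        gcongr

lemma volume_closedBall_eq {n : ℕ} (x : Euc n) {s : ℝ} (hs : 0 ≤ s) :
    volume (closedBall x s) = ENNReal.ofReal (s ^ n * volume.real (ball (0 : Euc n) 1)) := by
  rw [Measure.addHaar_closedBall _ _ hs, ENNReal.ofReal_mul (by positivity), finrank_euclideanSpace,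
    Fintype.card_fin, measureReal_def, ENNReal.ofReal_toReal measure_ball_lt_top.ne]

/-- Second derivatives of the gradient of a mollified field are controlled by the trace-free
symmetric gradient. -/
lemma ofReal_pd_pd_pd_cv_le {n : ℕ} (hn : 3 ≤ n) {φ : Euc n → ℝ} {s K : ℝ} (hs : 0 < s)
    (hφ : IsMoll φ s) (hφK : ∀ a b x, |pd a (pd b φ) x| ≤ K)
    {u : Fin n → Euc n → ℝ} (hu : ∀ i, Differentiable ℝ (u i))
    (hl : ∀ i j, LocallyIntegrable (pd j (u i))) (x : Euc n) (a b c k : Fin n) :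
    ENNReal.ofReal ((pd a (pd b (pd c (cv φ (u k)))) x) ^ 2) ≤
      ENNReal.ofReal (441 * K ^ 2 * s ^ n * volume.real (ball (0 : Euc n) 1)) *
        ∫⁻ y in closedBall x s, ENNReal.ofReal (frobSq (tfSym (jac u y))) := by
  set T : Fin n → Fin n → Fin n → Fin n → ℝ := fun a b c k =>
    pd a (pd b (pd c (cv φ (u k)))) x with hT
  have hul : ∀ i, LocallyIntegrable (u i) := fun i => (hu i).continuous.locallyIntegrable
  have hg : ∀ i, ContDiff ℝ ((⊤ : ℕ∞) : WithTop ℕ∞) (cv φ (u i)) := fun i =>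
    contDiff_cv hφ.isTest (hul i)
  have h12 : ∀ a b c k, T a b c k = T b a c k := fun a b c k =>
    congrFun (pd_comm a b (contDiff_pd c (hg k))) x
  have h23 : ∀ a b c k, T a b c k = T a c b k := fun a b c k => by
    simp only [hT, pd_comm b c (hg k)]
  have hTe : ∀ a b c k, T a b c k = cv (pd a (pd b φ)) (pd c (u k)) x := fun a b c k => by
    simp only [hT]
    rw [pd_cv hφ.isTest (hul k), cv_pd hφ.isTest (hu k) c (hl k c), pd_cv hφ.isTest (hl k c),
      pd_cv (hφ.isTest.pd b) (hl k c)]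
  have hcvt : ∀ a b i j, tfSym (fun i j => T a b j i) i j =
      cv (pd a (pd b φ)) (fun y => tfSym (jac u y) i j) x := by
    intro a b i j
    have h := tfSym_jac_cv ((hφ.isTest.pd b).pd a) hu hl x i j
    rw [← h]
    congr 1
    ext i j
    simp only [hTe, jac]
    rw [pd_cv ((hφ.isTest.pd b).pd a) (hul i), cv_pd ((hφ.isTest.pd b).pd a) (hu i) j (hl i j)]
  have : Nonempty (Fin n × Fin n × Fin n × Fin n) := ⟨(a, a, a, a)⟩
  obtain ⟨p, hp⟩ := Finite.exists_max fun p : Fin n × Fin n × Fin n × Fin n =>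
    |tfSym (fun i j => T p.1 p.2.1 j i) p.2.2.1 p.2.2.2|
  have hTb := abs_thirdDeriv_le hn T h12 h23 (fun a b i j => hp (a, b, i, j)) a b c k
  rw [hcvt] at hTb
  set F : Euc n → ℝ := fun y => tfSym (jac u y) p.2.2.1 p.2.2.2 with hF
  have hsup := enorm_cv_sq_le (pd_eq_zero_of_norm (pd_eq_zero_of_norm hφ.eq_zero p.2.1) p.1)
    (hφK p.1 p.2.1) (measurable_tfSym (P := jac u) (fun i j => measurable_pd j (u i))
      p.2.2.1 p.2.2.2) x
  rw [volume_closedBall_eq _ hs.le] at hsup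
  have hsq : T a b c k ^ 2 ≤ 441 * (cv (pd p.1 (pd p.2.1 φ)) F x) ^ 2 := by
    rw [← sq_abs, ← sq_abs (cv _ _ _)]
    have := pow_le_pow_left₀ (abs_nonneg _) hTb 2
    nlinarith
  calc ENNReal.ofReal (T a b c k ^ 2)
      ≤ ENNReal.ofReal (441 * (cv (pd p.1 (pd p.2.1 φ)) F x) ^ 2) := ENNReal.ofReal_le_ofReal hsq
    _ = ENNReal.ofReal 441 * ‖cv (pd p.1 (pd p.2.1 φ)) F x‖ₑ ^ 2 := by
        rw [ENNReal.ofReal_mul (by norm_num), enorm_sq_eq_ofReal]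
    _ ≤ ENNReal.ofReal 441 * (ENNReal.ofReal (K ^ 2) *
          ENNReal.ofReal (s ^ n * volume.real (ball (0 : Euc n) 1)) *
          ∫⁻ y in closedBall x s, ‖F y‖ₑ ^ 2) := by gcongr
    _ ≤ ENNReal.ofReal 441 * (ENNReal.ofReal (K ^ 2) *
          ENNReal.ofReal (s ^ n * volume.real (ball (0 : Euc n) 1)) *
          ∫⁻ y in closedBall x s, ENNReal.ofReal (frobSq (tfSym (jac u y)))) := by
        gcongr with y
        rw [enorm_sq_eq_ofReal]
        exact ENNReal.ofReal_le_ofReal (sq_le_frobSq (tfSym (jac u y)) p.2.2.1 p.2.2.2)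
    _ = _ := by
        rw [← ENNReal.ofReal_mul (by positivity), ← mul_assoc, ← ENNReal.ofReal_mul (by norm_num)]
        congr 2
        ring

/-- Multiplication by a cutoff: a differentiable function on `Ω` agrees on a ball with a globally
differentiable one of compact support. -/
lemma exists_truncation {n : ℕ} {Ω : Set (Euc n)} {f : Euc n → ℝ}
    (hf : ∀ x ∈ Ω, DifferentiableAt ℝ f x) (hfi : IntegrableOn f Ω)
    (hfd : ∀ j, IntegrableOn (pd j f) Ω) {x₀ : Euc n} {R : ℝ} (hR : 0 < R)
    (hΩ : closedBall x₀ (5 * R) ⊆ Ω) :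
    ∃ u : Euc n → ℝ, Differentiable ℝ u ∧ HasCompactSupport u ∧
      (∀ j, LocallyIntegrable (pd j u)) ∧ ∀ x ∈ ball x₀ (4 * R), u =ᶠ[nhds x] f := by
  obtain ⟨Cc, -, hcut⟩ := exists_cutoff n
  obtain ⟨η, hη, hη01, hη1, hη0, hηd⟩ := hcut x₀ R hR
  have hΩ' : ball x₀ (5 * R) ⊆ Ω := ball_subset_closedBall.trans hΩ
  have hzero : ∀ x, x ∉ closedBall x₀ (5 * R) → (fun x => η x * f x) =ᶠ[nhds x] fun _ => 0 := by
    intro x hx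
    filter_upwards [isClosed_closedBall.isOpen_compl.mem_nhds hx] with y hy
    simp only [(hη0 y fun h => hy (ball_subset_closedBall h)).1, zero_mul]
  refine ⟨fun x => η x * f x, fun x => ?_, hη.2.mul_right, fun j => ?_, fun x hx => ?_⟩
  · by_cases hx : x ∈ Ω
    · exact (hη.differentiable x).mul (hf x hx)
    · exact (hzero x fun h => hx (hΩ h)).differentiableAt_iff.2 (differentiableAt_const _)
  · have h1 : Integrable ((ball x₀ (5 * R)).indicator (pd j f)) :=
      ((hfd j).mono_set hΩ').integrable_indicator measurableSet_ball
    have h2 : Integrable ((ball x₀ (5 * R)).indicator f) :=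
      (hfi.mono_set hΩ').integrable_indicator measurableSet_ball
    have e : pd j (fun x => η x * f x) = fun x => η x * (ball x₀ (5 * R)).indicator (pd j f) x +
        pd j η x * (ball x₀ (5 * R)).indicator f x := by
      ext x
      by_cases hx : x ∈ Ω
      · rw [pd_mul j (hη.differentiable x) (hf x hx)]
        by_cases hxb : x ∈ ball x₀ (5 * R)
        · rw [indicator_of_mem hxb, indicator_of_mem hxb]
        · rw [(hη0 x hxb).1, (hη0 x hxb).2]
          simp
      · rw [(hη0 x fun h => hx (hΩ' h)).1, (hη0 x fun h => hx (hΩ' h)).2]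
        simp only [pd]
        rw [(hzero x fun h => hx (hΩ h)).fderiv_eq]
        simp
    rw [e]
    obtain ⟨M1, hM1⟩ := hη.bounded
    obtain ⟨M2, hM2⟩ := (hη.pd j).bounded
    exact ((h1.bdd_mul hη.continuous.aestronglyMeasurable (.of_forall hM1)).add
      (h2.bdd_mul (hη.pd j).continuous.aestronglyMeasurable (.of_forall hM2))).locallyIntegrable
  · filter_upwards [isOpen_ball.mem_nhds hx] with y hy
    simp [hη1 y hy]

/-- Local approximation of a Sobolev field by smooth fields whose gradient is nearly affine. -/
lemma exists_local_approx {n : ℕ} (hn : 3 ≤ n) : ∃ C : ℝ, 0 < C ∧ ∀ δ : ℝ, 0 < δ → δ ≤ 1 →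
    ∃ D : ℝ, 0 < D ∧ ∀ (Ω : Set (Euc n)) (v : Fin n → Euc n → ℝ),
    (∀ i, ∀ x ∈ Ω, DifferentiableAt ℝ (v i) x) → (∀ i, IntegrableOn (v i) Ω) →
    (∀ i j, IntegrableOn (pd j (v i)) Ω) → ∀ (x₀ : Euc n) (R : ℝ), 0 < R →
    ball x₀ (9 * R) ⊆ Ω → ∃ g : Fin n → Euc n → ℝ,
    (∀ i, ContDiff ℝ ((⊤ : ℕ∞) : WithTop ℕ∞) (g i)) ∧
    (∫⁻ x in ball x₀ (4 * R), ENNReal.ofReal (frobSq (jac v x - jac g x)) ≤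
      ENNReal.ofReal 16 * (∫⁻ x in ball x₀ (7 * R), ENNReal.ofReal (frobSq (tfSym (jac v x)))) +
      ENNReal.ofReal (C * δ ^ 2) * ∫⁻ x in ball x₀ (7 * R), ENNReal.ofReal (frobSq (jac v x))) ∧
    ∀ x ∈ ball x₀ (4 * R), ∀ a b c k, ENNReal.ofReal (pd a (pd b (pd c (g k))) x ^ 2) ≤
      ENNReal.ofReal (D / R ^ (n + 4)) *
        ∫⁻ x in ball x₀ (7 * R), ENNReal.ofReal (frobSq (tfSym (jac v x))) := by
  obtain ⟨C, hC, hloc⟩ := exists_local_compactSupport (n := n) (by omega)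
  obtain ⟨Cm, hCm, hmoll⟩ := exists_moll n
  refine ⟨C, hC, fun δ hδ hδ1 => ?_⟩
  set ω := volume.real (ball (0 : Euc n) 1) with hω
  have hω0 : 0 < ω := ENNReal.toReal_pos (measure_ball_pos _ _ one_pos).ne' measure_ball_lt_top.ne
  refine ⟨441 * Cm ^ 2 * ω / δ ^ (n + 4), by positivity, ?_⟩
  intro Ω v hv hvi hvd x₀ R hR hΩ
  obtain ⟨φ, hφ, -, -, hφ2⟩ := hmoll (δ * R) (by positivity)
  have hsR : δ * R ≤ R := by nlinarith
  have hcl : closedBall x₀ (5 * (7 / 4 * R)) ⊆ Ω :=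
    (closedBall_subset_ball (by linarith)).trans hΩ
  choose u hud hus hul huv' using fun i =>
    exists_truncation (hv i) (hvi i) (hvd i) (by positivity) hcl
  have huv : ∀ x ∈ ball x₀ (7 * R), jac u x = jac v x := by
    intro x hx
    ext i j
    simp only [jac, pd]
    rw [(huv' i x (by rwa [show 4 * (7 / 4 * R) = 7 * R by ring])).fderiv_eq]
  have hg : ∀ i, ContDiff ℝ ((⊤ : ℕ∞) : WithTop ℕ∞) (cv φ (u i)) := fun i =>
    contDiff_cv hφ.isTest (hud i).continuous.locallyIntegrable
  refine ⟨fun i => cv φ (u i), hg, ?_, ?_⟩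
  · have h := hloc x₀ R (δ * R) hR hsR φ hφ u hud hus hul
    rw [mul_div_cancel_right₀ _ hR.ne'] at h
    calc _ = ∫⁻ x in ball x₀ (4 * R),
          ENNReal.ofReal (frobSq (jac (fun i => u i - cv φ (u i)) x)) :=
          setLIntegral_congr_fun measurableSet_ball fun x hx => by
            have : jac (fun i => u i - cv φ (u i)) x = jac u x - jac (fun i => cv φ (u i)) x := by
              ext i j
              exact pd_sub j (hud i x) ((hg i).differentiable (by simp) x)
            simp only [this, huv x (ball_subset_ball (by linarith) hx)]
      _ ≤ _ := h
      _ = _ := by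
          congr 2
          · simp
          · exact setLIntegral_congr_fun measurableSet_ball fun x hx => by simp only [huv x hx]
          · exact setLIntegral_congr_fun measurableSet_ball fun x hx => by simp only [huv x hx]
  · intro x hx a b c k
    refine (ofReal_pd_pd_pd_cv_le hn (by positivity) hφ hφ2 hud hul x a b c k).trans ?_
    have hsub : closedBall x (δ * R) ⊆ ball x₀ (7 * R) := by
      intro y hy
      rw [mem_closedBall] at hy
      rw [mem_ball] at hx ⊢
      linarith [dist_triangle y x x₀]
    refine (mul_le_mul' (b := ENNReal.ofReal (441 * Cm ^ 2 * ω / δ ^ (n + 4) / R ^ (n + 4)))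
      (le_of_eq ?_) (lintegral_mono_set hsub)).trans (le_of_eq ?_)
    · congr 1
      rw [mul_pow, mul_pow]
      field_simp
      ring
    · congr 1
      exact setLIntegral_congr_fun measurableSet_ball fun x hx => by simp only [huv x hx]

/-- A quantity with increments bounded by `β` along a walk is controlled by the sum of `β`
over the vertices of the walk. -/
lemma le_add_sum_support {ι : Type*} {G : SimpleGraph ι} {f β : ι → ℝ≥0∞}
    (h : ∀ a b, G.Adj a b → f a ≤ f b + β a) {u v : ι} (p : G.Walk u v) :
    f u ≤ f v + (p.support.map β).sum := by
  induction p with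
  | nil => simp
  | @cons u w v huw p ih =>
    rw [SimpleGraph.Walk.support_cons, List.map_cons, List.sum_cons]
    calc f u ≤ f w + β u := h _ _ huw
      _ ≤ f v + (p.support.map β).sum + β u := by gcongr
      _ = _ := by ring

lemma le_add_tsum_of_reflTransGen {ι : Type*} {f β : ι → ℝ≥0∞} {adj : ι → ι → Prop} {S : Set ι}
    (hadj : ∀ a b, adj a b → f a ≤ f b + β a) (hsymm : ∀ a b, adj a b → adj b a) {q r : ι}
    (hq : q ∈ S) (h : Relation.ReflTransGen (fun a b => a ∈ S ∧ b ∈ S ∧ adj a b) q r) :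
    f q ≤ f r + ∑' a, S.indicator β a := by
  classical
  let G : SimpleGraph ι :=
    { Adj := fun a b => a ≠ b ∧ a ∈ S ∧ b ∈ S ∧ adj a b
      symm := ⟨fun a b hab => ⟨hab.1.symm, hab.2.2.1, hab.2.1, hsymm _ _ hab.2.2.2⟩⟩
      loopless := ⟨fun a ha => ha.1 rfl⟩ }
  have hr : G.Reachable q r := by
    rw [SimpleGraph.reachable_iff_reflTransGen]
    induction h with
    | refl => exact Relation.ReflTransGen.refl
    | @tail b c _ hbc ih =>
      by_cases hb : b = c
      · exact hb ▸ ih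
      · exact ih.tail ⟨hb, hbc⟩
  obtain ⟨w⟩ := hr
  have hp := w.toPath.2
  generalize (w.toPath : G.Walk q r) = p at hp
  have hsupp : ∀ {u v : ι} (p : G.Walk u v), u ∈ S → ∀ a ∈ p.support, a ∈ S := by
    intro u v p
    induction p with
    | nil => simp
    | @cons u w v hab p ih =>
      intro hu a ha
      rw [SimpleGraph.Walk.support_cons, List.mem_cons] at ha
      rcases ha with rfl | ha
      · exact hu
      · exact ih hab.2.2.1 a ha
  have hsup := hsupp p hq
  refine (le_add_sum_support (G := G) (f := f) (β := β) (fun a b hab => hadj a b hab.2.2.2) p).trans ?_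
  gcongr
  rw [← List.sum_toFinset β hp.support_nodup]
  calc ∑ a ∈ p.support.toFinset, β a = ∑ a ∈ p.support.toFinset, S.indicator β a :=
        Finset.sum_congr rfl fun a ha => by
          rw [indicator_of_mem (hsup a (List.mem_toFinset.1 ha))]
    _ ≤ _ := ENNReal.sum_le_tsum _

lemma ofReal_sq_le_add {x y b : ℝ} (h : |x - y| ≤ b) :
    ENNReal.ofReal (x ^ 2) ≤ ENNReal.ofReal (y ^ 2) + ENNReal.ofReal (b * (2 * |x| + b)) := by
  have hb : 0 ≤ b := (abs_nonneg _).trans h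
  rw [← ENNReal.ofReal_add (sq_nonneg _) (by positivity)]
  refine ENNReal.ofReal_le_ofReal ?_
  have h1 : x ^ 2 - y ^ 2 = (x - y) * (2 * x - (x - y)) := by ring
  have h2 : (x - y) * (2 * x - (x - y)) ≤ b * (2 * |x| + b) := by
    refine (le_abs_self _).trans ?_
    rw [abs_mul]
    gcongr
    refine (abs_sub _ _).trans ?_
    rw [abs_mul, abs_two]
    gcongr
  linarith

/-- A discrete Hardy inequality: a weighted `ℓ²` sum is controlled by its value at the root and
the increments along chains to the root, if the weights satisfy a shadow condition. -/
lemma discrete_hardy {ι : Type*} {m : ι → ℝ≥0∞} {A : ι → Set ι} {adj : ι → ι → Prop}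
    {r : ι} {K : ℝ} (hK : 0 < K) (hsymm : ∀ a b, adj a b → adj b a) (hself : ∀ q, q ∈ A q)
    (hroot : ∀ q, r ∈ A q)
    (hchain : ∀ q, Relation.ReflTransGen (fun a b => a ∈ A q ∧ b ∈ A q ∧ adj a b) q r)
    (hshadow : ∀ a, ∑' q, (A q).indicator (fun _ => m q) a ≤ ENNReal.ofReal K * m a)
    {G b : ι → ℝ} (hGb : ∀ p q, adj p q → |G p - G q| ≤ b p)
    (hfin : ∑' q, m q * ENNReal.ofReal (G q ^ 2) ≠ ∞) :
    ∑' q, m q * ENNReal.ofReal (G q ^ 2) ≤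
      ENNReal.ofReal (2 * K) * m r * ENNReal.ofReal (G r ^ 2) +
        ENNReal.ofReal (4 * K ^ 2 + 2 * K) * ∑' q, m q * ENNReal.ofReal (b q ^ 2) := by
  set β : ι → ℝ≥0∞ := fun q => ENNReal.ofReal (b q * (2 * |G q| + b q)) with hβ
  set S := ∑' q, m q * ENNReal.ofReal (G q ^ 2) with hS
  set B := ∑' q, m q * ENNReal.ofReal (b q ^ 2) with hB
  have h1 : ∀ q, ENNReal.ofReal (G q ^ 2) ≤
      ENNReal.ofReal (G r ^ 2) + ∑' a, (A q).indicator β a := fun q =>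
    le_add_tsum_of_reflTransGen (f := fun q => ENNReal.ofReal (G q ^ 2))
      (fun a c hac => ofReal_sq_le_add (hGb a c hac)) hsymm (hself q) (hchain q)
  have hm : ∑' q, m q ≤ ENNReal.ofReal K * m r := by
    refine le_trans (le_of_eq ?_) (hshadow r)
    exact tsum_congr fun q => by rw [indicator_of_mem (hroot q)]
  have h2 : ∑' q, m q * ∑' a, (A q).indicator β a ≤ ENNReal.ofReal K * ∑' a, m a * β a := by
    calc ∑' q, m q * ∑' a, (A q).indicator β a
        = ∑' q, ∑' a, m q * (A q).indicator β a := by simp_rw [ENNReal.tsum_mul_left]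
      _ = ∑' a, ∑' q, m q * (A q).indicator β a := ENNReal.tsum_comm
      _ = ∑' a, (∑' q, (A q).indicator (fun _ => m q) a) * β a := by
          refine tsum_congr fun a => ?_
          rw [← ENNReal.tsum_mul_right]
          refine tsum_congr fun q => ?_
          by_cases h : a ∈ A q
          · simp [h]
          · simp [h]
      _ ≤ ∑' a, ENNReal.ofReal K * (m a * β a) := by
          refine ENNReal.tsum_le_tsum fun a => ?_
          rw [← mul_assoc]
          exact mul_le_mul_left (hshadow a) _
      _ = _ := ENNReal.tsum_mul_left
  have h3 : ENNReal.ofReal K * ∑' a, m a * β a ≤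
      ENNReal.ofReal (1 / 2) * S + ENNReal.ofReal (2 * K ^ 2 + K) * B := by
    rw [hS, hB, ← ENNReal.tsum_mul_left, ← ENNReal.tsum_mul_left, ← ENNReal.tsum_mul_left,
      ← ENNReal.tsum_add]
    refine ENNReal.tsum_le_tsum fun a => ?_
    calc ENNReal.ofReal K * (m a * β a) = m a * ENNReal.ofReal (K * (b a * (2 * |G a| + b a))) := by
          rw [ENNReal.ofReal_mul hK.le]
          ring
      _ ≤ m a * ENNReal.ofReal (1 / 2 * G a ^ 2 + (2 * K ^ 2 + K) * b a ^ 2) := by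
          gcongr
          nlinarith [sq_nonneg (|G a| - 2 * K * b a), sq_abs (G a)]
      _ = _ := by
          rw [ENNReal.ofReal_add (by positivity) (by positivity),
            ENNReal.ofReal_mul (by norm_num), ENNReal.ofReal_mul (by positivity)]
          ring
  have h4 : S ≤ ENNReal.ofReal K * m r * ENNReal.ofReal (G r ^ 2) +
      (ENNReal.ofReal (1 / 2) * S + ENNReal.ofReal (2 * K ^ 2 + K) * B) := by
    calc S ≤ ∑' q, m q * (ENNReal.ofReal (G r ^ 2) + ∑' a, (A q).indicator β a) :=
          ENNReal.tsum_le_tsum fun q => mul_le_mul_right (h1 q) _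
      _ = (∑' q, m q) * ENNReal.ofReal (G r ^ 2) + ∑' q, m q * ∑' a, (A q).indicator β a := by
          simp_rw [mul_add]
          rw [ENNReal.tsum_add, ENNReal.tsum_mul_right]
      _ ≤ _ := by
          gcongr
          exact h2.trans h3
  have hhalf : S = ENNReal.ofReal (1 / 2) * S + ENNReal.ofReal (1 / 2) * S := by
    rw [← add_mul, ← ENNReal.ofReal_add (by norm_num) (by norm_num)]
    norm_num
  have h5 : ENNReal.ofReal (1 / 2) * S ≤ ENNReal.ofReal K * m r * ENNReal.ofReal (G r ^ 2) +
      ENNReal.ofReal (2 * K ^ 2 + K) * B := by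
    refine ENNReal.le_of_add_le_add_left (a := ENNReal.ofReal (1 / 2) * S)
      (ENNReal.mul_ne_top ENNReal.ofReal_ne_top hfin) ?_
    calc ENNReal.ofReal (1 / 2) * S + ENNReal.ofReal (1 / 2) * S = S := hhalf.symm
      _ ≤ _ := h4
      _ = _ := by ring
  calc S = ENNReal.ofReal 2 * (ENNReal.ofReal (1 / 2) * S) := by
        rw [← mul_assoc, ← ENNReal.ofReal_mul (by norm_num)]
        norm_num
    _ ≤ ENNReal.ofReal 2 * (ENNReal.ofReal K * m r * ENNReal.ofReal (G r ^ 2) +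
      ENNReal.ofReal (2 * K ^ 2 + K) * B) := by gcongr
    _ = _ := by
        rw [show 4 * K ^ 2 + 2 * K = 2 * (2 * K ^ 2 + K) by ring,
          ENNReal.ofReal_mul (by norm_num : (0 : ℝ) ≤ 2),
          ENNReal.ofReal_mul (p := 2) (q := 2 * K ^ 2 + K) (by norm_num)]
        ring

/-- A countable cover of `Ω` by balls well inside `Ω`, of bounded overlap, together with
chains `A q` joining every ball to a root ball through neighbouring balls, such that the shadow
of every ball is controlled. -/
structure IsChainCover {n : ℕ} {ι : Type*} (Ω : Set (Euc n)) (c : ι → Euc n) (R : ι → ℝ)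
    (A : ι → Set ι) (r : ι) (K : ℝ) : Prop where
  pos : ∀ q, 0 < R q
  ball_subset : ∀ q, ball (c q) (9 * R q) ⊆ Ω
  cover : ∀ x ∈ Ω, ∃ q, x ∈ closedBall (c q) (R q)
  overlap : ∀ F : Euc n → ℝ≥0∞, Measurable F →
    ∑' q, ∫⁻ x in ball (c q) (7 * R q), F x ≤ ENNReal.ofReal K * ∫⁻ x in Ω, F x
  self_mem : ∀ q, q ∈ A q
  root_mem : ∀ q, r ∈ A q
  chain : ∀ q, Relation.ReflTransGen (fun a b => a ∈ A q ∧ b ∈ A q ∧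
    (dist (c a) (c b) + R b < 4 * R a ∧ dist (c b) (c a) + R a < 4 * R b)) q r
  shadow : ∀ a, ∑' q, (A q).indicator (fun _ => ENNReal.ofReal (R q ^ n)) a ≤
    ENNReal.ofReal K * ENNReal.ofReal (R a ^ n)
  shadow' : ∀ a, ∑' q, (A q).indicator (fun _ => ENNReal.ofReal (R q ^ (n + 2))) a ≤
    ENNReal.ofReal K * ENNReal.ofReal (R a ^ (n + 2))

lemma tsum_pow_le_of_disjoint {n : ℕ} {ι : Type*} [Countable ι] {c : ι → Euc n} {R : ι → ℝ}
    (hR : ∀ q, 0 < R q)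
    (hd : Pairwise (Function.onFun Disjoint fun q => closedBall (c q) (R q / 5))) {S : Set ι}
    {z : Euc n} {ρ : ℝ} (hρ : 0 ≤ ρ) (hS : ∀ q ∈ S, closedBall (c q) (R q / 5) ⊆ closedBall z ρ) :
    ∑' q, S.indicator (fun q => ENNReal.ofReal (R q ^ n)) q ≤ ENNReal.ofReal ((5 * ρ) ^ n) := by
  set ω := volume.real (ball (0 : Euc n) 1) with hω
  have hω0 : 0 < ω := ENNReal.toReal_pos (measure_ball_pos volume _ one_pos).ne'
    measure_ball_lt_top.ne
  have h1 : ∑' q : S, volume (closedBall (c q) (R q / 5)) ≤ volume (closedBall z ρ) := by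
    rw [← measure_iUnion (f := fun q : S => closedBall (c q) (R q / 5)) (fun a b hab => hd fun h => hab (Subtype.ext h))
      fun _ => measurableSet_closedBall]
    exact measure_mono (iUnion_subset fun q => hS q q.2)
  rw [tsum_subtype S fun q => volume (closedBall (c q) (R q / 5)),
    volume_closedBall_eq _ hρ] at h1
  have h2 : ∀ q, S.indicator (fun q => ENNReal.ofReal (R q ^ n)) q =
      ENNReal.ofReal (5 ^ n / ω) *
        S.indicator (fun q => volume (closedBall (c q) (R q / 5))) q := by
    intro q
    by_cases hq : q ∈ S
    · rw [indicator_of_mem hq, indicator_of_mem hq,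
        volume_closedBall_eq _ (by have := hR q; positivity), ← ENNReal.ofReal_mul (by positivity)]
      congr 1
      rw [← hω, div_pow]
      field_simp
    · simp [hq]
  simp_rw [h2]
  rw [ENNReal.tsum_mul_left]
  refine (mul_le_mul_right h1 _).trans (le_of_eq ?_)
  rw [← ENNReal.ofReal_mul (by positivity)]
  congr 1
  rw [← hω, mul_pow]
  field_simp

lemma infDist_frontier_pos {n : ℕ} (hn : 0 < n) {Ω : Set (Euc n)} (hΩo : IsOpen Ω)
    (hΩb : Bornology.IsBounded Ω) {x : Euc n} (hx : x ∈ Ω) : 0 < infDist x (frontier Ω) := by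
  have : Nonempty (Fin n) := ⟨⟨0, hn⟩⟩
  have hne : (frontier Ω).Nonempty := by
    rw [nonempty_frontier_iff]
    refine ⟨⟨x, hx⟩, fun h => ?_⟩
    rw [h] at hΩb
    exact NormedSpace.unbounded_univ ℝ (Euc n) hΩb
  rw [← isClosed_frontier.notMem_iff_infDist_pos hne]
  exact fun h => (disjoint_frontier_iff_isOpen.2 hΩo).le_bot ⟨h, hx⟩

lemma ball_infDist_frontier_subset {n : ℕ} {Ω : Set (Euc n)} (hΩo : IsOpen Ω) {x : Euc n}
    (hx : x ∈ Ω) {ρ : ℝ} (hρ : 0 < ρ) (h : ρ ≤ infDist x (frontier Ω)) : ball x ρ ⊆ Ω := by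
  refine (convex_ball x ρ).isPreconnected.subset_left_of_subset_union hΩo
    isClosed_closure.isOpen_compl (disjoint_compl_right.mono_right
      (compl_subset_compl.2 subset_closure)) ?_ ⟨x, mem_ball_self hρ, hx⟩
  intro y hy
  by_cases hyΩ : y ∈ Ω
  · exact Or.inl hyΩ
  · refine Or.inr fun hyc => ?_
    have hyf : y ∈ frontier Ω := by
      rw [hΩo.frontier_eq]
      exact ⟨hyc, hyΩ⟩
    have := infDist_le_dist_of_mem (x := x) hyf
    rw [mem_ball, dist_comm] at hy
    linarith

lemma tsum_setLIntegral_le {α ι : Type*} [MeasurableSpace α] [Countable ι] {μ : Measure α}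
    {Ω : Set α} (hΩ : MeasurableSet Ω) {B : ι → Set α} (hB : ∀ q, MeasurableSet (B q))
    (hsub : ∀ q, B q ⊆ Ω) {K : ℝ≥0∞}
    (hK : ∀ z ∈ Ω, ∑' q, (B q).indicator (fun _ => (1 : ℝ≥0∞)) z ≤ K) {F : α → ℝ≥0∞}
    (hF : Measurable F) : ∑' q, ∫⁻ x in B q, F x ∂μ ≤ K * ∫⁻ x in Ω, F x ∂μ := by
  calc ∑' q, ∫⁻ x in B q, F x ∂μ = ∑' q, ∫⁻ x in Ω, (B q).indicator F x ∂μ := by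
        refine tsum_congr fun q => ?_
        rw [setLIntegral_indicator (hB q), inter_eq_left.2 (hsub q)]
    _ = ∫⁻ x in Ω, ∑' q, (B q).indicator F x ∂μ := by
        rw [lintegral_tsum fun q => (hF.indicator (hB q)).aemeasurable]
    _ ≤ ∫⁻ x in Ω, K * F x ∂μ := by
        refine setLIntegral_mono' hΩ fun x hx => ?_
        calc ∑' q, (B q).indicator F x
            = ∑' q, (B q).indicator (fun _ => (1 : ℝ≥0∞)) x * F x := by
              refine tsum_congr fun q => ?_
              by_cases h : x ∈ B q
              · rw [indicator_of_mem h, indicator_of_mem h, one_mul]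
              · rw [indicator_of_notMem h, indicator_of_notMem h, zero_mul]
          _ ≤ _ := by
              rw [ENNReal.tsum_mul_right]
              exact mul_le_mul_left (hK x hx) _
    _ = _ := lintegral_const_mul _ hF

set_option maxHeartbeats 1000000 in

lemma exists_isChainCover {n : ℕ} (hn : 0 < n) {Ω : Set (Euc n)} (hΩo : IsOpen Ω)
    (hΩb : Bornology.IsBounded Ω) (hJ : IsJohnDomain Ω) :
    ∃ (ι : Type) (_ : Countable ι) (c : ι → Euc n) (R : ι → ℝ) (A : ι → Set ι) (r : ι) (K : ℝ),
      0 < K ∧ IsChainCover Ω c R A r K := by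
  obtain ⟨C, hC, x₀, hx₀, hγ⟩ := hJ
  set d : Euc n → ℝ := fun x => infDist x (frontier Ω) with hd
  have hdpos : ∀ x ∈ Ω, 0 < d x := fun x hx => infDist_frontier_pos hn hΩo hΩb hx
  have hdlip : ∀ x y, d x ≤ d y + dist x y := fun x y => infDist_le_infDist_add_dist
  obtain ⟨M, hM⟩ : ∃ M, ∀ x ∈ Ω, d x / 200 ≤ M := by
    obtain ⟨M, hM⟩ := hΩb.subset_closedBall x₀
    refine ⟨(d x₀ + M) / 200, fun x hx => ?_⟩
    have h1 := hdlip x x₀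
    have h2 := mem_closedBall.1 (hM hx)
    linarith
  obtain ⟨u, huΩ, hudisj, hucov⟩ := Vitali.exists_disjoint_subfamily_covering_enlargement_closedBall
    Ω (fun x => x) (fun x => d x / 200) M hM 5 (by norm_num)
  have hucount : u.Countable := hudisj.countable_of_nonempty_interior fun x hx => by
    rw [interior_closedBall _ (by have := hdpos x (huΩ hx); positivity)]
    exact ⟨x, mem_ball_self (by have := hdpos x (huΩ hx); positivity)⟩
  have : Countable u := hucount
  set c : u → Euc n := fun q => q with hc
  set R : u → ℝ := fun q => d q / 40 with hRdef
  have hcΩ : ∀ q, c q ∈ Ω := fun q => huΩ q.2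
  have hdc : ∀ q, d (c q) = 40 * R q := fun q => by
    rw [hRdef]
    ring
  have hR : ∀ q, 0 < R q := fun q => by
    have := hdpos _ (hcΩ q)
    rw [hdc] at this
    linarith
  have hdisj : Pairwise (Function.onFun Disjoint fun q => closedBall (c q) (R q / 5)) := by
    intro p q hpq
    have := hudisj p.2 q.2 fun h => hpq (Subtype.ext h)
    have e : ∀ q : u, d q / 200 = R q / 5 := fun q => by
      rw [hRdef]
      ring
    simp only [Function.onFun] at this ⊢
    rw [e, e] at this
    exact this
  have hcover : ∀ x ∈ Ω, ∃ q, x ∈ closedBall (c q) (R q) := by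
    intro x hx
    obtain ⟨b, hb, hsub⟩ := hucov x hx
    refine ⟨⟨b, hb⟩, ?_⟩
    have hxb := hsub (mem_closedBall_self (by have := hdpos x hx; positivity))
    rw [mem_closedBall] at hxb ⊢
    refine hxb.trans (le_of_eq ?_)
    simp only [hRdef]
    ring
  obtain ⟨r, hr⟩ := hcover x₀ hx₀
  set Λ := 41 * C + 1 with hΛ
  have hΛ1 : 1 ≤ Λ := by linarith
  set A : u → Set u := fun q => {a | dist (c q) (c a) ≤ Λ * R a} with hA
  -- comparison of the distance to the boundary with the radius of a covering ball
  have hcomp : ∀ q x, x ∈ closedBall (c q) (R q) → d x ≤ 41 * R q ∧ 39 * R q ≤ d x := by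
    intro q x hx
    rw [mem_closedBall] at hx
    have h1 := hdlip x (c q)
    have h2 := hdlip (c q) x
    rw [dist_comm] at h2
    rw [hdc] at h1 h2
    constructor <;> linarith
  have hAmem : ∀ q a, ∀ L : ℝ, ∀ γ : ℝ → Euc n, γ 0 = c q →
      (∀ s ∈ Icc 0 L, ∀ t ∈ Icc 0 L, dist (γ s) (γ t) ≤ |s - t|) →
      (∀ t ∈ Icc 0 L, t / C ≤ d (γ t)) → ∀ t ∈ Icc 0 L, γ t ∈ closedBall (c a) (R a) →
      a ∈ A q := by
    intro q a L γ hγ0 hγlip hγd t ht hta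
    have h1 := hγlip 0 ⟨le_rfl, ht.1.trans ht.2⟩ t ht
    rw [hγ0, zero_sub, abs_neg, abs_of_nonneg ht.1] at h1
    have h2 := (hγd t ht).trans (hcomp a _ hta).1
    rw [div_le_iff₀ (by linarith)] at h2
    have h3 := dist_triangle (c q) (γ t) (c a)
    have h4 := mem_closedBall.1 hta
    change dist (c q) (c a) ≤ Λ * R a
    rw [hΛ]
    linarith
  have hshadow : ∀ a, ∑' q, (A q).indicator (fun _ => ENNReal.ofReal (R q ^ n)) a ≤
      ENNReal.ofReal ((5 * (1 + 2 * Λ)) ^ n) * ENNReal.ofReal (R a ^ n) := by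
    intro a
    have hRa := hR a
    have h1 := tsum_pow_le_of_disjoint hR hdisj (S := {q | dist (c q) (c a) ≤ Λ * R a})
      (z := c a) (ρ := (1 + 2 * Λ) * R a) (by positivity) ?_
    · rw [← ENNReal.ofReal_mul (by positivity), ← mul_pow]
      refine le_trans (le_of_eq (tsum_congr fun q => ?_)) (h1.trans (le_of_eq ?_))
      · simp only [indicator, hA, mem_ofPred_eq]
      · congr 2
        ring
    · intro q hq x hx
      rw [mem_closedBall] at hx ⊢
      have h2 := hdlip (c q) (c a)
      rw [hdc, hdc] at h2
      have h3 := dist_triangle x (c q) (c a)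
      have h4 : dist (c q) (c a) ≤ Λ * R a := hq
      have h5 : 0 ≤ Λ * R a := by positivity
      linarith
  set K : ℝ := 63 ^ n + (5 * (1 + 2 * Λ)) ^ n * (1 + Λ) ^ 2 with hK
  have hKle : (5 * (1 + 2 * Λ)) ^ n ≤ K := by
    have h1 : (1 : ℝ) ≤ (1 + Λ) ^ 2 := by nlinarith
    have h2 : 0 ≤ (5 * (1 + 2 * Λ)) ^ n := by positivity
    have h3 : (0 : ℝ) ≤ 63 ^ n := by positivity
    nlinarith
  have hK63 : (63 : ℝ) ^ n ≤ K := by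
    have : 0 ≤ (5 * (1 + 2 * Λ)) ^ n * (1 + Λ) ^ 2 := by positivity
    linarith
  have hK' : (5 * (1 + 2 * Λ)) ^ n * (1 + Λ) ^ 2 ≤ K := by
    have : (0 : ℝ) ≤ 63 ^ n := by positivity
    linarith
  have hballs : ∀ q, ball (c q) (9 * R q) ⊆ Ω := fun q =>
    ball_infDist_frontier_subset hΩo (hcΩ q) (by have := hR q; positivity)
      (by have := hdc q; have := hR q; simp only [hd] at *; linarith)
  refine ⟨u, inferInstance, c, R, A, r, K, by positivity, hR, hballs, hcover, ?_, ?_, ?_, ?_,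
    fun a => (hshadow a).trans (by gcongr), ?_⟩
  · intro F hF
    have hcount : ∀ z ∈ Ω, ∑' q, (ball (c q) (7 * R q)).indicator (fun _ => (1 : ℝ≥0∞)) z ≤
        ENNReal.ofReal K := by
      intro z hz
      have hdz := hdpos z hz
      have hq : ∀ q, z ∈ ball (c q) (7 * R q) → d z ≤ 47 * R q ∧ 33 * R q ≤ d z := by
        intro q hq
        rw [mem_ball] at hq
        have h1 := hdlip z (c q)
        have h2 := hdlip (c q) z
        rw [dist_comm] at h2
        rw [hdc] at h1 h2
        constructor <;> linarith
      have h1 := tsum_pow_le_of_disjoint hR hdisj (S := {q | z ∈ ball (c q) (7 * R q)})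
        (z := z) (ρ := d z / 4) (by positivity) ?_
      · calc ∑' q, (ball (c q) (7 * R q)).indicator (fun _ => (1 : ℝ≥0∞)) z
            ≤ ∑' q, ENNReal.ofReal ((47 / d z) ^ n) *
              {q | z ∈ ball (c q) (7 * R q)}.indicator (fun q => ENNReal.ofReal (R q ^ n)) q := by
              refine ENNReal.tsum_le_tsum fun q => ?_
              by_cases hzq : z ∈ ball (c q) (7 * R q)
              · have hmem : q ∈ {q | z ∈ ball (c q) (7 * R q)} := hzq
                rw [indicator_of_mem hzq, indicator_of_mem hmem,
                  ← ENNReal.ofReal_mul (by positivity), ← mul_pow, ← ENNReal.ofReal_one]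
                refine ENNReal.ofReal_le_ofReal (one_le_pow₀ ?_)
                rw [div_mul_eq_mul_div, one_le_div hdz]
                exact (hq q hzq).1
              · rw [indicator_of_notMem hzq]
                exact zero_le
          _ ≤ ENNReal.ofReal ((47 / d z) ^ n) * ENNReal.ofReal ((5 * (d z / 4)) ^ n) := by
              rw [ENNReal.tsum_mul_left]
              gcongr
          _ ≤ ENNReal.ofReal K := by
              rw [← ENNReal.ofReal_mul (by positivity), ← mul_pow]
              refine ENNReal.ofReal_le_ofReal (le_trans ?_ hK63)
              refine pow_le_pow_left₀ (by positivity) ?_ n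
              have : 47 / d z * (5 * (d z / 4)) = 47 * 5 / 4 := by field_simp
              rw [this]
              norm_num
      · intro q hzq x hx
        have hzq : z ∈ ball (c q) (7 * R q) := hzq
        have hzq' := mem_ball.1 hzq
        rw [mem_closedBall] at hx ⊢
        rw [dist_comm] at hzq'
        have h2 := dist_triangle x (c q) z
        have := (hq q hzq).2
        have := hR q
        linarith
    exact tsum_setLIntegral_le hΩo.measurableSet (fun q => measurableSet_ball)
      (fun q => (ball_subset_ball (by have := hR q; linarith)).trans (hballs q)) hcount hF
  · intro q
    change dist (c q) (c q) ≤ Λ * R q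
    rw [dist_self]
    have := hR q
    positivity
  · intro q
    obtain ⟨L, hL, γ, hγ0, hγL, -, hγlip, hγd⟩ := hγ (c q) (hcΩ q)
    exact hAmem q r L γ hγ0 hγlip hγd L ⟨hL, le_rfl⟩ (hγL ▸ hr)
  · intro q
    obtain ⟨L, hL, γ, hγ0, hγL, hγΩ, hγlip, hγd⟩ := hγ (c q) (hcΩ q)
    have hmemA := fun a => hAmem q a L γ hγ0 hγlip hγd
    set η := 40 * R q / (2 * C) with hη
    have hRq := hR q
    have hη0 : 0 < η := by positivity
    have hlow : ∀ t ∈ Icc 0 L, η ≤ d (γ t) := by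
      intro t ht
      rcases le_total t (20 * R q) with h | h
      · have h1 := hγlip 0 ⟨le_rfl, hL⟩ t ht
        rw [hγ0, zero_sub, abs_neg, abs_of_nonneg ht.1] at h1
        have h2 := hdlip (c q) (γ t)
        rw [hdc] at h2
        have h3 : η ≤ 20 * R q := by
          rw [hη, div_le_iff₀ (by positivity)]
          nlinarith
        linarith
      · refine le_trans ?_ (hγd t ht)
        rw [hη, div_le_div_iff₀ (by positivity) (by positivity)]
        nlinarith
    set ρ := η / 82 with hρ
    have hρ0 : 0 < ρ := by positivity
    have hRρ : ∀ t ∈ Icc 0 L, ∀ a, γ t ∈ closedBall (c a) (R a) → 2 * ρ ≤ R a := by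
      intro t ht a ha
      have h1 := (hlow t ht).trans (hcomp a _ ha).1
      rw [hρ]
      linarith
    have hstep : ∀ s ∈ Icc 0 L, ∀ t ∈ Icc 0 L, |s - t| ≤ ρ → ∀ a b,
        γ s ∈ closedBall (c a) (R a) → γ t ∈ closedBall (c b) (R b) →
        a ∈ A q ∧ b ∈ A q ∧
          (dist (c a) (c b) + R b < 4 * R a ∧ dist (c b) (c a) + R a < 4 * R b) := by
      intro s hs t ht hst a b ha hb
      refine ⟨hmemA a s hs ha, hmemA b t ht hb, ?_⟩
      have h1 := hRρ s hs a ha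
      have h2 := hRρ t ht b hb
      have h3 := (hγlip s hs t ht).trans hst
      have h4 := (hcomp a _ ha)
      have h5 := (hcomp b _ hb)
      have h6 := hdlip (γ s) (γ t)
      have h7 := hdlip (γ t) (γ s)
      rw [dist_comm (γ t)] at h7
      rw [mem_closedBall] at ha hb
      have h8 := dist_triangle4 (c a) (γ s) (γ t) (c b)
      rw [dist_comm (c a) (γ s)] at h8
      rw [dist_comm (c b) (c a)]
      constructor <;> linarith
    have hind : ∀ k : ℕ, ∀ t ∈ Icc 0 L, t ≤ k * ρ → ∀ b, γ t ∈ closedBall (c b) (R b) →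
        Relation.ReflTransGen (fun a b => a ∈ A q ∧ b ∈ A q ∧
          (dist (c a) (c b) + R b < 4 * R a ∧ dist (c b) (c a) + R a < 4 * R b)) q b := by
      intro k
      induction k with
      | zero =>
        intro t ht htk b hb
        have ht0 : t = 0 := le_antisymm (by simpa using htk) ht.1
        subst ht0
        exact Relation.ReflTransGen.single (hstep 0 ht 0 ht (by simpa using hρ0.le) q b
          (by rw [hγ0]; exact mem_closedBall_self hRq.le) hb)
      | succ k ih =>
        intro t ht htk b hb
        have hs : max (t - ρ) 0 ∈ Icc 0 L :=
          ⟨le_max_right _ _, max_le (by linarith [ht.2]) hL⟩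
        obtain ⟨a, ha⟩ := hcover _ (hγΩ _ hs)
        have hk : max (t - ρ) 0 ≤ k * ρ := by
          refine max_le ?_ (by positivity)
          push_cast at htk
          linarith
        refine (ih _ hs hk a ha).tail (hstep _ hs t ht ?_ a b ha hb)
        rw [abs_le]
        have := le_max_left (t - ρ) 0
        have := max_le (show t - ρ ≤ t by linarith) ht.1
        constructor <;> linarith
    obtain ⟨k, hk⟩ := exists_nat_ge (L / ρ)
    rw [div_le_iff₀ hρ0] at hk
    exact hind k L ⟨hL, le_rfl⟩ hk r (hγL ▸ hr)
  · intro a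
    have hRa := hR a
    calc ∑' q, (A q).indicator (fun _ => ENNReal.ofReal (R q ^ (n + 2))) a
        ≤ ∑' q, ENNReal.ofReal (((1 + Λ) * R a) ^ 2) *
          (A q).indicator (fun _ => ENNReal.ofReal (R q ^ n)) a := by
          refine ENNReal.tsum_le_tsum fun q => ?_
          by_cases h : a ∈ A q
          · rw [indicator_of_mem h, indicator_of_mem h, ← ENNReal.ofReal_mul (by positivity)]
            refine ENNReal.ofReal_le_ofReal ?_
            rw [pow_add, mul_comm]
            have hRq := hR q
            have h2 := hdlip (c q) (c a)
            rw [hdc, hdc] at h2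
            have h4 : dist (c q) (c a) ≤ Λ * R a := h
            have h5 : 0 ≤ Λ * R a := by positivity
            gcongr
            linarith
          · simp [h]
      _ ≤ ENNReal.ofReal (((1 + Λ) * R a) ^ 2) *
          (ENNReal.ofReal ((5 * (1 + 2 * Λ)) ^ n) * ENNReal.ofReal (R a ^ n)) := by
          rw [ENNReal.tsum_mul_left]
          gcongr
          exact hshadow a
      _ ≤ _ := by
          rw [← ENNReal.ofReal_mul (by positivity), ← ENNReal.ofReal_mul (by positivity),
            ← ENNReal.ofReal_mul (by positivity)]
          refine ENNReal.ofReal_le_ofReal ?_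
          calc ((1 + Λ) * R a) ^ 2 * ((5 * (1 + 2 * Λ)) ^ n * R a ^ n)
              = (5 * (1 + 2 * Λ)) ^ n * (1 + Λ) ^ 2 * R a ^ (n + 2) := by ring
            _ ≤ _ := by gcongr

/-- Pointwise bound of the difference of two convolutions by the `L²` distance. -/
lemma abs_cv_sub_cv_le {n : ℕ} {ψ f p : Euc n → ℝ} {s K B w ρ : ℝ} (hψ : IsTest ψ)
    (hψ0 : ∀ x, s < ‖x‖ → ψ x = 0) (hψK : ∀ x, |ψ x| ≤ K) (hs : 0 ≤ s) (hB : 0 ≤ B) (hw : 0 ≤ w)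
    (hf : Measurable f) (hfl : LocallyIntegrable f) (hp : Continuous p) {x c : Euc n}
    (hsub : closedBall x s ⊆ ball c ρ) {E : ℝ}
    (hE : ∫⁻ y in ball c ρ, ‖f y - p y‖ₑ ^ 2 ≤ ENNReal.ofReal (w ^ 2 * E))
    (hKB : K ^ 2 * (s ^ n * volume.real (ball (0 : Euc n) 1)) * E ≤ B ^ 2) :
    |cv ψ f x - cv ψ p x| ≤ B * w := by
  have h1 : cv ψ f x - cv ψ p x = cv ψ (fun y => f y - p y) x := by
    simp only [cv, mul_sub]
    exact (integral_sub (hψ.integrable_mul hfl x)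
      (hψ.integrable_mul hp.locallyIntegrable x)).symm
  have h2 := enorm_cv_sq_le hψ0 hψK (hf.sub hp.measurable) x
  rw [volume_closedBall_eq _ hs] at h2
  change ‖cv ψ (fun y => f y - p y) x‖ₑ ^ 2 ≤ _ at h2
  rw [← h1, enorm_sq_eq_ofReal] at h2
  have h3 : ENNReal.ofReal ((cv ψ f x - cv ψ p x) ^ 2) ≤ ENNReal.ofReal ((B * w) ^ 2) := by
    calc ENNReal.ofReal ((cv ψ f x - cv ψ p x) ^ 2)
        ≤ ENNReal.ofReal (K ^ 2) * ENNReal.ofReal (s ^ n * volume.real (ball (0 : Euc n) 1)) *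
          ENNReal.ofReal (w ^ 2 * E) := by
          refine h2.trans ?_
          gcongr
          exact (lintegral_mono_set hsub).trans hE
      _ ≤ _ := by
          rw [← ENNReal.ofReal_mul (sq_nonneg _), ← ENNReal.ofReal_mul (by positivity)]
          refine ENNReal.ofReal_le_ofReal ?_
          calc K ^ 2 * (s ^ n * volume.real (ball (0 : Euc n) 1)) * (w ^ 2 * E)
              = K ^ 2 * (s ^ n * volume.real (ball (0 : Euc n) 1)) * E * w ^ 2 := by ring
            _ ≤ B ^ 2 * w ^ 2 := by gcongr
            _ = _ := by ring
  rw [ENNReal.ofReal_le_ofReal_iff (sq_nonneg _)] at h3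
  exact abs_le_of_sq_le_sq h3 (by positivity)

lemma IsMoll.abs_cv_sub_le {n : ℕ} {φ p : Euc n → ℝ} {s T m : ℝ} (hφ : IsMoll φ s)
    (hp : LocallyIntegrable p) {x : Euc n} (h : ∀ y ∈ closedBall x s, |p y - m| ≤ T) :
    |cv φ p x - m| ≤ T := by
  have h1 : cv φ p x - m = ∫ t, φ t * (p (x - t) - m) := by
    simp only [mul_sub]
    rw [integral_sub (hφ.isTest.integrable_mul hp x) (hφ.isTest.integrable.mul_const m),
      integral_mul_const, hφ.integral_eq_one, one_mul]
    rfl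
  have h2 : T = ∫ t, φ t * T := by rw [integral_mul_const, hφ.integral_eq_one, one_mul]
  rw [h1, h2, ← Real.norm_eq_abs]
  refine norm_integral_le_of_norm_le (hφ.isTest.integrable.mul_const T)
    (Filter.Eventually.of_forall fun t => ?_)
  rw [norm_mul, Real.norm_of_nonneg (hφ.nonneg t), Real.norm_eq_abs]
  by_cases ht : ‖t‖ ≤ s
  · exact mul_le_mul_of_nonneg_left (h _ (by simpa [dist_eq_norm] using ht)) (hφ.nonneg t)
  · rw [hφ.eq_zero t (not_le.1 ht), zero_mul, zero_mul]

lemma abs_sub_le_of_abs_pd_le {n : ℕ} {f : Euc n → ℝ} (hf : Differentiable ℝ f) {c : Euc n}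
    {ρ M : ℝ} (hM : 0 ≤ M) (h : ∀ x ∈ ball c ρ, ∀ a, |pd a f x| ≤ M) {y : Euc n}
    (hy : y ∈ ball c ρ) : |f y - f c| ≤ n * M * ρ := by
  have hρ : 0 < ρ := dist_nonneg.trans_lt (mem_ball.1 hy)
  have h1 : ∀ x ∈ ball c ρ, ‖fderiv ℝ f x‖ ≤ n * M := by
    intro x hx
    refine ContinuousLinearMap.opNorm_le_bound _ (by positivity) fun t => ?_
    rw [Real.norm_eq_abs]
    refine abs_le_of_sq_le_sq ?_ (by positivity)
    have hsum : ∑ i, pd i f x ^ 2 ≤ (n * M) ^ 2 := by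
      calc ∑ i, pd i f x ^ 2 ≤ ∑ _i : Fin n, M ^ 2 :=
            Finset.sum_le_sum fun i _ => sq_le_sq.2 ((h x hx i).trans (le_abs_self M))
        _ = n * M ^ 2 := by simp
        _ ≤ n ^ 2 * M ^ 2 := by
            gcongr
            exact_mod_cast Nat.le_self_pow two_ne_zero n
        _ = _ := by ring
    calc (fderiv ℝ f x t) ^ 2 ≤ ‖t‖ ^ 2 * ∑ i, pd i f x ^ 2 := fderiv_apply_sq_le f x t
      _ ≤ ‖t‖ ^ 2 * (n * M) ^ 2 := by gcongr
      _ = _ := by ring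
  have h2 := (convex_ball c ρ).norm_image_sub_le_of_norm_fderiv_le
    (fun x _ => hf x) h1 (mem_ball_self hρ) hy
  rw [Real.norm_eq_abs] at h2
  refine h2.trans ?_
  gcongr
  rw [← dist_eq_norm]
  exact (mem_ball.1 hy).le

/-- Moments of a function close to a nearly affine one. -/
lemma exists_moment_bounds (n : ℕ) {Cm : ℝ} (hCm : 0 < Cm) : ∃ B : ℝ, 0 < B ∧
    ∀ (f p : Euc n → ℝ) (c c' : Euc n) (R s w : ℝ) (φ : Euc n → ℝ), 0 < R → 0 < s → R ≤ 4 * s →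
    0 ≤ w → closedBall c' s ⊆ ball c (4 * R) → IsMoll φ s → (∀ x, |φ x| ≤ Cm / s ^ n) →
    (∀ a x, |pd a φ x| ≤ Cm / s ^ (n + 1)) → Measurable f → LocallyIntegrable f →
    ContDiff ℝ ((⊤ : ℕ∞) : WithTop ℕ∞) p →
    ∫⁻ x in ball c (4 * R), ‖f x - p x‖ₑ ^ 2 ≤ ENNReal.ofReal (w ^ 2 * R ^ n) →
    (∀ x ∈ ball c (4 * R), ∀ a b, |pd a (pd b p) x| ≤ w / R ^ 2) →
    (∀ a, |cv (pd a φ) f c' - pd a p c| ≤ B * w / R) ∧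
    |cv φ f c' - p c| ≤ B * (w + R * ∑ a, |pd a p c|) ∧
    ∀ y ∈ ball c (4 * R), |p y - p c| ≤ B * (w + R * ∑ a, |pd a p c|) := by
  set ω := volume.real (ball (0 : Euc n) 1) with hω
  have hω0 : 0 ≤ ω := measureReal_nonneg
  refine ⟨4 * Cm * 2 ^ n * (1 + ω) + 4 * n + 16 * n ^ 2, by positivity, ?_⟩
  intro f p c c' R s w φ hR hs hRs hw hsub hφ hφ0 hφ1 hf hfl hp hE hpp
  set S := ∑ a, |pd a p c| with hS
  have hS0 : 0 ≤ S := Finset.sum_nonneg fun _ _ => abs_nonneg _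
  have hdp : ∀ a, ∀ y ∈ ball c (4 * R), |pd a p y - pd a p c| ≤ 4 * n * w / R := by
    intro a y hy
    refine (abs_sub_le_of_abs_pd_le ((contDiff_pd a hp).differentiable (by simp))
      (M := w / R ^ 2) (by positivity) (fun x hx b => hpp x hx b a) hy).trans (le_of_eq ?_)
    field_simp
  have hp3 : ∀ y ∈ ball c (4 * R), |p y - p c| ≤ 4 * n * (R * S) + 16 * n ^ 2 * w := by
    intro y hy
    refine (abs_sub_le_of_abs_pd_le (hp.differentiable (by simp))
      (M := S + 4 * n * w / R) (by positivity) (fun x hx a => ?_) hy).trans (le_of_eq ?_)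
    · have h1 := hdp a x hx
      have h2 : |pd a p c| ≤ S :=
        Finset.single_le_sum (f := fun a => |pd a p c|) (fun _ _ => abs_nonneg _)
          (Finset.mem_univ a)
      have h3 := abs_sub_abs_le_abs_sub (pd a p x) (pd a p c)
      linarith
    · field_simp
      ring
  have hpow : R ^ n ≤ 4 ^ n * s ^ n := by
    rw [← mul_pow]
    exact pow_le_pow_left₀ hR.le hRs n
  have h4 : (4 : ℝ) ^ n = (2 ^ n) ^ 2 := by
    rw [← pow_mul, mul_comm, pow_mul]
    norm_num
  have hω1 : ω ≤ (1 + ω) ^ 2 := by nlinarith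
  have hB0 : |cv φ f c' - cv φ p c'| ≤ Cm * 2 ^ n * (1 + ω) * w := by
    refine abs_cv_sub_cv_le hφ.isTest hφ.eq_zero hφ0 hs.le (by positivity) hw hf hfl
      hp.continuous hsub hE ?_
    calc (Cm / s ^ n) ^ 2 * (s ^ n * ω) * R ^ n
        ≤ (Cm / s ^ n) ^ 2 * (s ^ n * (1 + ω) ^ 2) * (4 ^ n * s ^ n) := by gcongr
      _ = _ := by
          rw [h4]
          field_simp
  have hB1 : ∀ a, |cv (pd a φ) f c' - cv (pd a φ) p c'| ≤ 4 * Cm * 2 ^ n * (1 + ω) / R * w := by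
    intro a
    refine abs_cv_sub_cv_le (hφ.isTest.pd a) (pd_eq_zero_of_norm hφ.eq_zero a) (hφ1 a) hs.le
      (by positivity) hw hf hfl hp.continuous hsub hE ?_
    have hsR : (1 / s) ^ 2 ≤ (4 / R) ^ 2 := by
      refine pow_le_pow_left₀ (by positivity) ?_ 2
      rw [div_le_div_iff₀ hs hR]
      linarith
    calc (Cm / s ^ (n + 1)) ^ 2 * (s ^ n * ω) * R ^ n
        ≤ (Cm / s ^ (n + 1)) ^ 2 * (s ^ n * (1 + ω) ^ 2) * (4 ^ n * s ^ n) := by gcongr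
      _ = Cm ^ 2 * (1 + ω) ^ 2 * 4 ^ n * (1 / s) ^ 2 := by
          field_simp
          ring
      _ ≤ Cm ^ 2 * (1 + ω) ^ 2 * 4 ^ n * (4 / R) ^ 2 := by gcongr
      _ = _ := by
          rw [h4]
          field_simp
  have hX : 0 ≤ 4 * Cm * 2 ^ n * (1 + ω) := by positivity
  have hRS : 0 ≤ R * S := by positivity
  have hn0 : (0 : ℝ) ≤ n := Nat.cast_nonneg n
  refine ⟨fun a => ?_, ?_, fun y hy => ?_⟩
  · have h1 : |cv (pd a φ) p c' - pd a p c| ≤ 4 * n * w / R := by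
      rw [cv_pd hφ.isTest (hp.differentiable (by simp)) a
        (contDiff_pd a hp).continuous.locallyIntegrable]
      exact hφ.abs_cv_sub_le (contDiff_pd a hp).continuous.locallyIntegrable
        fun y hy => hdp a y (hsub hy)
    have h2 := abs_sub_le (cv (pd a φ) f c') (cv (pd a φ) p c') (pd a p c)
    have h3 : 0 ≤ 16 * (n : ℝ) ^ 2 * w / R := by positivity
    calc |cv (pd a φ) f c' - pd a p c|
        ≤ 4 * Cm * 2 ^ n * (1 + ω) / R * w + 4 * n * w / R + 16 * (n : ℝ) ^ 2 * w / R := by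
          linarith [hB1 a]
      _ = _ := by ring
  · have h1 : |cv φ p c' - p c| ≤ 4 * n * (R * S) + 16 * n ^ 2 * w :=
      hφ.abs_cv_sub_le hp.continuous.locallyIntegrable fun y hy => hp3 y (hsub hy)
    have h2 := abs_sub_le (cv φ f c') (cv φ p c') (p c)
    nlinarith [mul_nonneg hX hRS, mul_nonneg hX hw, mul_nonneg hn0 hw,
      mul_nonneg (sq_nonneg (n : ℝ)) hRS]
  · have h1 := hp3 y hy
    nlinarith [mul_nonneg hX hRS, mul_nonneg hX hw, mul_nonneg hn0 hw,
      mul_nonneg (sq_nonneg (n : ℝ)) hRS]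

lemma ofReal_pow_mul_cv_sq_le {n : ℕ} {ψ f : Euc n → ℝ} {R Cm : ℝ} (hR : 0 < R) {i : ℕ}
    (hψ0 : ∀ x, R < ‖x‖ → ψ x = 0) (hψK : ∀ x, |ψ x| ≤ Cm / R ^ (n + i)) (hf : Measurable f)
    (x : Euc n) : ENNReal.ofReal (R ^ (n + 2 * i)) * ENNReal.ofReal (cv ψ f x ^ 2) ≤
      ENNReal.ofReal (Cm ^ 2 * volume.real (ball (0 : Euc n) 1)) *
        ∫⁻ y in ball x (7 * R), ‖f y‖ₑ ^ 2 := by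
  have h := enorm_cv_sq_le hψ0 hψK hf x
  rw [volume_closedBall_eq _ hR.le, enorm_sq_eq_ofReal] at h
  refine (mul_le_mul_right h _).trans ?_
  rw [← mul_assoc, ← ENNReal.ofReal_mul (sq_nonneg _), ← ENNReal.ofReal_mul (by positivity)]
  refine mul_le_mul' (ENNReal.ofReal_le_ofReal (le_of_eq ?_))
    (lintegral_mono_set (closedBall_subset_ball (by linarith)))
  field_simp
  ring

lemma add_sum_sq_le {n : ℕ} (x : ℝ) (y : Fin n → ℝ) :
    (x + ∑ a, y a) ^ 2 ≤ 2 * x ^ 2 + 2 * n * ∑ a, y a ^ 2 := by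
  have h := sq_sum_le_card_mul_sum_sq (s := Finset.univ) (f := y)
  rw [Finset.card_univ, Fintype.card_fin] at h
  nlinarith [sq_nonneg (x - ∑ a, y a)]

/-- A Hardy type inequality of second order on chain covers: a function which is close, on every
ball of the cover, to a nearly affine one, is controlled by the errors and its moments on
the root ball. -/
lemma IsChainCover.exists_hardy {n : ℕ} {ι : Type*} [Countable ι] {Ω : Set (Euc n)}
    {c : ι → Euc n} {R : ι → ℝ} {A : ι → Set ι} {r : ι} {K : ℝ} (h : IsChainCover Ω c R A r K)
    (hK : 0 < K) {Cm : ℝ} (hCm : 0 < Cm) {φ : ι → Euc n → ℝ} (hφ : ∀ q, IsMoll (φ q) (R q))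
    (hφ0 : ∀ q x, |φ q x| ≤ Cm / R q ^ n) (hφ1 : ∀ q a x, |pd a (φ q) x| ≤ Cm / R q ^ (n + 1)) :
    ∃ C : ℝ≥0∞, C ≠ ∞ ∧ ∀ (f : Euc n → ℝ) (p : ι → Euc n → ℝ) (w : ι → ℝ) (T : ℝ≥0∞),
      Measurable f → LocallyIntegrable f → ∫⁻ x in Ω, ‖f x‖ₑ ^ 2 ≠ ∞ →
      (∀ q, ContDiff ℝ ((⊤ : ℕ∞) : WithTop ℕ∞) (p q)) → (∀ q, 0 ≤ w q) →
      (∀ q, ∫⁻ x in ball (c q) (4 * R q), ‖f x - p q x‖ₑ ^ 2 ≤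
        ENNReal.ofReal (w q ^ 2 * R q ^ n)) →
      (∀ q, ∀ x ∈ ball (c q) (4 * R q), ∀ a b, |pd a (pd b (p q)) x| ≤ w q / R q ^ 2) →
      ∑' q, ENNReal.ofReal (w q ^ 2 * R q ^ n) ≤ T →
      ENNReal.ofReal (cv (φ r) f (c r) ^ 2) ≤ T →
      (∀ a, ENNReal.ofReal (cv (pd a (φ r)) f (c r) ^ 2) ≤ T) →
      ∫⁻ x in Ω, ‖f x‖ₑ ^ 2 ≤ C * T := by
  obtain ⟨B, hB, hBm⟩ := exists_moment_bounds n hCm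
  set ω := volume.real (ball (0 : Euc n) 1) with hω
  have hω0 : 0 ≤ ω := measureReal_nonneg
  have hsymm : ∀ a b, (dist (c a) (c b) + R b < 4 * R a ∧ dist (c b) (c a) + R a < 4 * R b) →
      (dist (c b) (c a) + R a < 4 * R b ∧ dist (c a) (c b) + R b < 4 * R a) :=
    fun a b hab => ⟨hab.2, hab.1⟩
  -- the constants of the successive estimates
  set c₁ : ℝ≥0∞ := ENNReal.ofReal (2 * K) * ENNReal.ofReal (R r ^ (n + 2)) +
    ENNReal.ofReal (4 * K ^ 2 + 2 * K) * ENNReal.ofReal (4 * B ^ 2) with hc₁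
  set c₂ : ℝ≥0∞ := ENNReal.ofReal (8 * B ^ 2 * (1 + n * B) ^ 2) +
    ENNReal.ofReal (8 * B ^ 2 * n) * (n * c₁) with hc₂
  set c₃ : ℝ≥0∞ := ENNReal.ofReal (2 * K) * ENNReal.ofReal (R r ^ n) +
    ENNReal.ofReal (4 * K ^ 2 + 2 * K) * c₂ with hc₃
  have hc₁t : c₁ ≠ ∞ := by finiteness
  have hc₂t : c₂ ≠ ∞ := by finiteness
  have hc₃t : c₃ ≠ ∞ := by finiteness
  refine ⟨ENNReal.ofReal 3 * (1 + ENNReal.ofReal ω * c₂ + ENNReal.ofReal ω * c₃),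
    by finiteness, ?_⟩
  intro f p w T hf hfl hfin hp hw hE hpp hWT hAT hHT
  set H : Fin n → ι → ℝ := fun a q => cv (pd a (φ q)) f (c q) with hH
  set G : ι → ℝ := fun q => cv (φ q) f (c q) with hG
  set b : ι → ℝ := fun q => 2 * B * ((1 + n * B) * w q + ∑ a, R q * |H a q|) with hb
  have hmom : ∀ q q', dist (c q) (c q') + R q' < 4 * R q → dist (c q') (c q) + R q < 4 * R q' →
      (∀ a, |H a q' - pd a (p q) (c q)| ≤ B * w q / R q) ∧
      |G q' - p q (c q)| ≤ B * (w q + R q * ∑ a, |pd a (p q) (c q)|) ∧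
      ∀ y ∈ ball (c q) (4 * R q),
        |p q y - p q (c q)| ≤ B * (w q + R q * ∑ a, |pd a (p q) (c q)|) := by
    intro q q' h1 h2
    have h0 : 0 ≤ dist (c q') (c q) := dist_nonneg
    refine hBm f (p q) (c q) (c q') (R q) (R q') (w q) (φ q') (h.pos q) (h.pos q') (by linarith)
      (hw q) ?_ (hφ q') (hφ0 q') (hφ1 q') hf hfl (hp q) (hE q) (hpp q)
    intro y hy
    rw [mem_closedBall] at hy
    rw [mem_ball]
    have h3 := dist_triangle y (c q') (c q)
    rw [dist_comm (c q)] at h1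
    linarith
  have hself : ∀ q, dist (c q) (c q) + R q < 4 * R q := fun q => by
    rw [dist_self]
    have := h.pos q
    linarith
  have hpd : ∀ q, B * (w q + R q * ∑ a, |pd a (p q) (c q)|) ≤ b q / 2 := by
    intro q
    have hRq := h.pos q
    have h1 : R q * ∑ a, |pd a (p q) (c q)| ≤ ∑ a, (R q * |H a q| + B * w q) := by
      rw [Finset.mul_sum]
      refine Finset.sum_le_sum fun a _ => ?_
      have h2 := (hmom q q (hself q) (hself q)).1 a
      have h3 := abs_sub_abs_le_abs_sub (pd a (p q) (c q)) (H a q)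
      rw [abs_sub_comm] at h3
      have h4 : |pd a (p q) (c q)| ≤ |H a q| + B * w q / R q := by linarith
      calc R q * |pd a (p q) (c q)| ≤ R q * (|H a q| + B * w q / R q) := by gcongr
        _ = _ := by field_simp
    rw [Finset.sum_add_distrib, Finset.sum_const, Finset.card_univ, Fintype.card_fin,
      nsmul_eq_mul] at h1
    calc B * (w q + R q * ∑ a, |pd a (p q) (c q)|)
        ≤ B * (w q + (∑ a, R q * |H a q| + n * (B * w q))) := by gcongr
      _ = b q / 2 := by
          rw [hb]
          ring
  have hsumfin : ∀ (i : ℕ) (ψ : ι → Euc n → ℝ), (∀ q x, R q < ‖x‖ → ψ q x = 0) →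
      (∀ q x, |ψ q x| ≤ Cm / R q ^ (n + i)) →
      ∑' q, ENNReal.ofReal (R q ^ (n + 2 * i)) * ENNReal.ofReal (cv (ψ q) f (c q) ^ 2) ≠ ∞ := by
    intro i ψ hψ0 hψ
    refine ne_top_of_le_ne_top
      (b := ENNReal.ofReal (Cm ^ 2 * ω) * (ENNReal.ofReal K * ∫⁻ x in Ω, ‖f x‖ₑ ^ 2))
      (by finiteness) ((ENNReal.tsum_le_tsum fun q =>
        ofReal_pow_mul_cv_sq_le (h.pos q) (hψ0 q) (hψ q) hf (c q)).trans ?_)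
    rw [ENNReal.tsum_mul_left]
    gcongr
    exact h.overlap _ (hf.enorm.pow_const 2)
  have hSH : ∀ a, ∑' q, ENNReal.ofReal (R q ^ (n + 2)) * ENNReal.ofReal (H a q ^ 2) ≤ c₁ * T := by
    intro a
    refine (discrete_hardy hK hsymm h.self_mem h.root_mem h.chain h.shadow'
      (b := fun q => 2 * B * w q / R q) (fun q q' hqq => ?_)
      (hsumfin 1 _ (fun q => pd_eq_zero_of_norm (hφ q).eq_zero a) (fun q => hφ1 q a))).trans ?_
    · have h1 := (hmom q q (hself q) (hself q)).1 a
      have h2 := (hmom q q' hqq.1 hqq.2).1 a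
      have h3 := abs_sub_le (H a q) (pd a (p q) (c q)) (H a q')
      rw [abs_sub_comm (pd a (p q) (c q))] at h3
      refine h3.trans ((add_le_add h1 h2).trans (le_of_eq ?_))
      ring
    · have h1 : ∑' q, ENNReal.ofReal (R q ^ (n + 2)) * ENNReal.ofReal ((2 * B * w q / R q) ^ 2) =
          ENNReal.ofReal (4 * B ^ 2) * ∑' q, ENNReal.ofReal (w q ^ 2 * R q ^ n) := by
        rw [← ENNReal.tsum_mul_left]
        refine tsum_congr fun q => ?_
        have hRq := h.pos q
        rw [← ENNReal.ofReal_mul (by positivity), ← ENNReal.ofReal_mul (by positivity)]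
        congr 1
        field_simp
        ring
      rw [h1, hc₁, add_mul, mul_assoc (ENNReal.ofReal (4 * K ^ 2 + 2 * K))]
      gcongr
      exact hHT a
  have hSB : ∑' q, ENNReal.ofReal (R q ^ n) * ENNReal.ofReal (b q ^ 2) ≤ c₂ * T := by
    calc ∑' q, ENNReal.ofReal (R q ^ n) * ENNReal.ofReal (b q ^ 2)
        ≤ ∑' q, (ENNReal.ofReal (8 * B ^ 2 * (1 + n * B) ^ 2) *
            ENNReal.ofReal (w q ^ 2 * R q ^ n) + ENNReal.ofReal (8 * B ^ 2 * n) *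
            ∑ a, ENNReal.ofReal (R q ^ (n + 2)) * ENNReal.ofReal (H a q ^ 2)) := by
          refine ENNReal.tsum_le_tsum fun q => ?_
          have hRq := h.pos q
          have h1 := add_sum_sq_le ((1 + n * B) * w q) fun a => R q * |H a q|
          have h2 : ∑ a, ENNReal.ofReal (R q ^ (n + 2)) * ENNReal.ofReal (H a q ^ 2) =
              ENNReal.ofReal (R q ^ n * ∑ a, (R q * |H a q|) ^ 2) := by
            rw [Finset.mul_sum, ENNReal.ofReal_sum_of_nonneg fun _ _ => by positivity]
            refine Finset.sum_congr rfl fun a _ => ?_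
            rw [← ENNReal.ofReal_mul (by positivity)]
            congr 1
            rw [mul_pow, sq_abs]
            ring
          have hs0 : 0 ≤ ∑ a, (R q * |H a q|) ^ 2 := Finset.sum_nonneg fun _ _ => sq_nonneg _
          rw [h2, ← ENNReal.ofReal_mul (by positivity), ← ENNReal.ofReal_mul (by positivity),
            ← ENNReal.ofReal_mul (by positivity),
            ← ENNReal.ofReal_add (by positivity) (by positivity)]
          refine ENNReal.ofReal_le_ofReal ?_
          calc R q ^ n * b q ^ 2
              = 4 * B ^ 2 * R q ^ n * ((1 + n * B) * w q + ∑ a, R q * |H a q|) ^ 2 := by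
                rw [hb]
                ring
            _ ≤ 4 * B ^ 2 * R q ^ n * (2 * ((1 + n * B) * w q) ^ 2 +
                2 * n * ∑ a, (R q * |H a q|) ^ 2) := by gcongr
            _ = _ := by ring
      _ = ENNReal.ofReal (8 * B ^ 2 * (1 + n * B) ^ 2) *
            (∑' q, ENNReal.ofReal (w q ^ 2 * R q ^ n)) + ENNReal.ofReal (8 * B ^ 2 * n) *
            ∑ a, ∑' q, ENNReal.ofReal (R q ^ (n + 2)) * ENNReal.ofReal (H a q ^ 2) := by
          rw [ENNReal.tsum_add, ENNReal.tsum_mul_left, ENNReal.tsum_mul_left,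
            Summable.tsum_finsetSum fun _ _ => ENNReal.summable]
      _ ≤ ENNReal.ofReal (8 * B ^ 2 * (1 + n * B) ^ 2) * T + ENNReal.ofReal (8 * B ^ 2 * n) *
            ∑ _a : Fin n, c₁ * T := by
          gcongr with a
          exact hSH a
      _ = c₂ * T := by
          rw [Finset.sum_const, Finset.card_univ, Fintype.card_fin, nsmul_eq_mul, hc₂]
          ring
  have hSG : ∑' q, ENNReal.ofReal (R q ^ n) * ENNReal.ofReal (G q ^ 2) ≤ c₃ * T := by
    refine (discrete_hardy hK hsymm h.self_mem h.root_mem h.chain h.shadow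
      (b := b) (fun q q' hqq => ?_)
      (hsumfin 0 _ (fun q => (hφ q).eq_zero) hφ0)).trans ?_
    · have h1 := (hmom q q (hself q) (hself q)).2.1
      have h2 := (hmom q q' hqq.1 hqq.2).2.1
      have h3 := abs_sub_le (G q) (p q (c q)) (G q')
      rw [abs_sub_comm (p q (c q))] at h3
      linarith [hpd q]
    · rw [hc₃, add_mul, mul_assoc (ENNReal.ofReal (4 * K ^ 2 + 2 * K))]
      gcongr
  calc ∫⁻ x in Ω, ‖f x‖ₑ ^ 2 ≤ ∫⁻ x in ⋃ q, closedBall (c q) (R q), ‖f x‖ₑ ^ 2 :=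
        lintegral_mono_set fun x hx => mem_iUnion.2 (h.cover x hx)
    _ ≤ ∑' q, ∫⁻ x in closedBall (c q) (R q), ‖f x‖ₑ ^ 2 := lintegral_iUnion_le _ _
    _ ≤ ∑' q, ENNReal.ofReal 3 * (ENNReal.ofReal (w q ^ 2 * R q ^ n) +
          ENNReal.ofReal ω * (ENNReal.ofReal (R q ^ n) * ENNReal.ofReal (b q ^ 2)) +
          ENNReal.ofReal ω * (ENNReal.ofReal (R q ^ n) * ENNReal.ofReal (G q ^ 2))) := by
        refine ENNReal.tsum_le_tsum fun q => ?_
        have hRq := h.pos q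
        have hsub : closedBall (c q) (R q) ⊆ ball (c q) (4 * R q) :=
          closedBall_subset_ball (by linarith)
        have hpt : ∀ x ∈ closedBall (c q) (R q), ‖f x‖ₑ ^ 2 ≤
            ENNReal.ofReal 3 * (‖f x - p q x‖ₑ ^ 2 + ENNReal.ofReal (b q ^ 2 + G q ^ 2)) := by
          intro x hx
          rw [enorm_sq_eq_ofReal, enorm_sq_eq_ofReal, ← ENNReal.ofReal_add (by positivity)
            (by positivity), ← ENNReal.ofReal_mul (by norm_num)]
          refine ENNReal.ofReal_le_ofReal ?_
          obtain ⟨-, h2, h3⟩ := hmom q q (hself q) (hself q)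
          have h4 := h3 x (hsub hx)
          have h5 := abs_sub_le (p q x) (p q (c q)) (G q)
          rw [abs_sub_comm (p q (c q))] at h5
          have h6 : (p q x - G q) ^ 2 ≤ b q ^ 2 := by
            rw [← sq_abs]
            exact pow_le_pow_left₀ (abs_nonneg _) (by linarith [hpd q]) 2
          nlinarith [sq_nonneg (f x - p q x - (p q x - G q)), sq_nonneg (f x - p q x - G q),
            sq_nonneg (p q x - G q - G q)]
        calc ∫⁻ x in closedBall (c q) (R q), ‖f x‖ₑ ^ 2
            ≤ ∫⁻ x in closedBall (c q) (R q),
                ENNReal.ofReal 3 * (‖f x - p q x‖ₑ ^ 2 + ENNReal.ofReal (b q ^ 2 + G q ^ 2)) :=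
              setLIntegral_mono' measurableSet_closedBall hpt
          _ = ENNReal.ofReal 3 * ((∫⁻ x in closedBall (c q) (R q), ‖f x - p q x‖ₑ ^ 2) +
                ENNReal.ofReal (b q ^ 2 + G q ^ 2) * volume (closedBall (c q) (R q))) := by
              rw [lintegral_const_mul' _ _ ENNReal.ofReal_ne_top,
                lintegral_add_right _ measurable_const, setLIntegral_const]
          _ ≤ ENNReal.ofReal 3 * (ENNReal.ofReal (w q ^ 2 * R q ^ n) +
                ENNReal.ofReal (b q ^ 2 + G q ^ 2) * ENNReal.ofReal (R q ^ n * ω)) := by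
              rw [volume_closedBall_eq _ hRq.le]
              gcongr
              exact (lintegral_mono_set hsub).trans (hE q)
          _ = _ := by
              rw [ENNReal.ofReal_add (sq_nonneg _) (sq_nonneg _),
                ENNReal.ofReal_mul (p := R q ^ n) (by positivity)]
              ring
    _ = ENNReal.ofReal 3 * ((∑' q, ENNReal.ofReal (w q ^ 2 * R q ^ n)) +
          ENNReal.ofReal ω * (∑' q, ENNReal.ofReal (R q ^ n) * ENNReal.ofReal (b q ^ 2)) +
          ENNReal.ofReal ω * ∑' q, ENNReal.ofReal (R q ^ n) * ENNReal.ofReal (G q ^ 2)) := by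
        rw [ENNReal.tsum_mul_left, ENNReal.tsum_add, ENNReal.tsum_add, ENNReal.tsum_mul_left,
          ENNReal.tsum_mul_left]
    _ ≤ ENNReal.ofReal 3 * (T + ENNReal.ofReal ω * (c₂ * T) + ENNReal.ofReal ω * (c₃ * T)) := by
        gcongr
    _ = _ := by ring

/-- Averages of a derivative against a test function are controlled by the function itself. -/
lemma exists_cv_pd_sq_le {n : ℕ} {ψ : Euc n → ℝ} (hψ : IsTest ψ) {R : ℝ} (hR : 0 < R)
    (hψ0 : ∀ x, R < ‖x‖ → ψ x = 0) {Ω : Set (Euc n)} {x₀ : Euc n}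
    (hΩ : closedBall x₀ (5 * R) ⊆ Ω) :
    ∃ C : ℝ≥0∞, C ≠ ∞ ∧ ∀ f : Euc n → ℝ, (∀ x ∈ Ω, DifferentiableAt ℝ f x) →
      IntegrableOn f Ω → (∀ j, IntegrableOn (pd j f) Ω) → ∀ b,
      ENNReal.ofReal (cv ψ (Ω.indicator (pd b f)) x₀ ^ 2) ≤ C * ∫⁻ x in Ω, ‖f x‖ₑ ^ 2 := by
  choose M hM using fun b => (hψ.pd b).bounded
  refine ⟨∑ b, ENNReal.ofReal (M b ^ 2) * volume (closedBall (0 : Euc n) R), ?_, ?_⟩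
  · exact ENNReal.sum_ne_top.2 fun b _ =>
      ENNReal.mul_ne_top ENNReal.ofReal_ne_top measure_closedBall_lt_top.ne
  intro f hf hfi hfd b
  obtain ⟨u, hud, -, hul, huf⟩ := exists_truncation hf hfi hfd hR hΩ
  have hsub : closedBall x₀ R ⊆ ball x₀ (4 * R) := closedBall_subset_ball (by linarith)
  have hΩ' : closedBall x₀ R ⊆ Ω := (closedBall_subset_closedBall (by linarith)).trans hΩ
  have h1 : cv ψ (Ω.indicator (pd b f)) x₀ = cv (pd b ψ) u x₀ := by
    rw [cv_pd hψ hud b (hul b)]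
    refine integral_congr_ae (.of_forall fun t => ?_)
    by_cases ht : R < ‖t‖
    · simp only [hψ0 t ht, zero_mul]
    · have hmem : x₀ - t ∈ closedBall x₀ R := by
        simpa [mem_closedBall, dist_eq_norm] using ht
      simp only [indicator_of_mem (hΩ' hmem), pd, (huf _ (hsub hmem)).fderiv_eq]
  rw [h1, ← enorm_sq_eq_ofReal]
  refine (enorm_cv_sq_le (pd_eq_zero_of_norm hψ0 b) (hM b) hud.continuous.measurable x₀).trans ?_
  refine mul_le_mul' (Finset.single_le_sum
    (f := fun b => ENNReal.ofReal (M b ^ 2) * volume (closedBall (0 : Euc n) R))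
    (fun _ _ => zero_le) (Finset.mem_univ b)) ?_
  calc ∫⁻ y in closedBall x₀ R, ‖u y‖ₑ ^ 2 = ∫⁻ y in closedBall x₀ R, ‖f y‖ₑ ^ 2 :=
        setLIntegral_congr_fun measurableSet_closedBall fun y hy => by
          simp only [(huf y (hsub hy)).eq_of_nhds]
    _ ≤ _ := lintegral_mono_set hΩ'

lemma exists_small_scale {M : ℝ} (hM : 0 ≤ M) : ∃ δ : ℝ, 0 < δ ∧ δ ≤ 1 ∧ M * δ ^ 2 ≤ 1 / 2 := by
  have h : 0 < 2 * (M + 1) := by positivity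
  have h1 : 1 / (2 * (M + 1)) ≤ 1 := by
    rw [div_le_one h]
    linarith
  refine ⟨1 / (2 * (M + 1)), by positivity, h1, ?_⟩
  have h2 : M * (1 / (2 * (M + 1))) ≤ 1 / 2 := by
    rw [mul_one_div, div_le_div_iff₀ h two_pos]
    linarith
  calc M * (1 / (2 * (M + 1))) ^ 2 = M * (1 / (2 * (M + 1))) * (1 / (2 * (M + 1))) := by ring
    _ ≤ 1 / 2 * 1 := by gcongr
    _ = 1 / 2 := mul_one _

lemma ENNReal.le_two_mul_of_le_add {X α β : ℝ≥0∞} (hX : X ≠ ∞) (hβ : β ≤ 2⁻¹)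
    (h : X ≤ α + β * X) : X ≤ 2 * α := by
  have h1 : 2⁻¹ * X + 2⁻¹ * X ≤ α + 2⁻¹ * X := by
    rw [← add_mul, ENNReal.inv_two_add_inv_two, one_mul]
    exact h.trans (by gcongr)
  have h2 : 2⁻¹ * X ≤ α := (ENNReal.add_le_add_iff_right (by finiteness)).1 h1
  calc X = 2 * (2⁻¹ * X) := by
        rw [← mul_assoc, ENNReal.mul_inv_cancel two_ne_zero ENNReal.ofNat_ne_top, one_mul]
    _ ≤ 2 * α := by gcongr

/-- The gradient of a vector field on a bounded John domain is controlled by its trace-free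
symmetric part and the field itself. -/
lemma exists_lintegral_frobSq_jac_le {n : ℕ} (hn : 3 ≤ n) {Ω : Set (Euc n)} (hΩo : IsOpen Ω)
    (hΩb : Bornology.IsBounded Ω) (hJ : IsJohnDomain Ω) :
    ∃ C : ℝ≥0∞, C ≠ ∞ ∧ ∀ v : Fin n → Euc n → ℝ, (∀ i, ∀ x ∈ Ω, DifferentiableAt ℝ (v i) x) →
      (∀ i, IntegrableOn (v i) Ω) → (∀ i j, IntegrableOn (pd j (v i)) Ω) →
      ∫⁻ x in Ω, ENNReal.ofReal (frobSq (jac v x)) ≠ ∞ →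
      ∫⁻ x in Ω, ENNReal.ofReal (frobSq (jac v x)) ≤
        C * ((∫⁻ x in Ω, ENNReal.ofReal (∑ i, v i x ^ 2)) +
          ∫⁻ x in Ω, ENNReal.ofReal (frobSq (tfSym (jac v x)))) := by
  obtain ⟨ι, _, c, R, A, r, K, hK, h⟩ := exists_isChainCover (by omega) hΩo hΩb hJ
  obtain ⟨Cm, hCm, hmoll⟩ := exists_moll n
  choose φ hφ hφ0 hφ1 using fun q =>
    (hmoll (R q) (h.pos q)).imp fun _ h => (⟨h.1, h.2.1, h.2.2.1⟩ : _ ∧ _ ∧ _)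
  obtain ⟨C₁, hC₁, hhardy⟩ := h.exists_hardy hK hCm hφ hφ0 hφ1
  obtain ⟨Ca, hCa, happ⟩ := exists_local_approx hn
  have hroot : closedBall (c r) (5 * R r) ⊆ Ω :=
    (closedBall_subset_ball (by linarith [h.pos r])).trans (h.ball_subset r)
  obtain ⟨B, hB, hBv⟩ := exists_cv_pd_sq_le (hφ r).isTest (h.pos r) (hφ r).eq_zero hroot
  choose B' hB' hBv' using fun a => exists_cv_pd_sq_le ((hφ r).isTest.pd a) (h.pos r)
    (pd_eq_zero_of_norm (hφ r).eq_zero a) hroot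
  set Cr : ℝ≥0∞ := B + ∑ a, B' a with hCr
  have hCrt : Cr ≠ ∞ := ENNReal.add_ne_top.2 ⟨hB, ENNReal.sum_ne_top.2 fun a _ => hB' a⟩
  obtain ⟨δ, hδ, hδ1, hδM⟩ := exists_small_scale
    (M := n * n * C₁.toReal * K * Ca) (by positivity)
  obtain ⟨D, hD, happ⟩ := happ δ hδ hδ1
  refine ⟨2 * (n * n * C₁ * (ENNReal.ofReal K * ENNReal.ofReal (16 + D) + Cr)),
    by finiteness, ?_⟩
  intro v hv hvi hvd hX
  choose g hg hg4 hgD using fun q => happ Ω v hv hvi hvd (c q) (R q) (h.pos q) (h.ball_subset q)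
  have hmj : Measurable fun x => ENNReal.ofReal (frobSq (jac v x)) :=
    (continuous_frobSq.measurable.comp (measurable_pi_lambda _ fun i =>
      measurable_pi_lambda _ fun j => measurable_pd j (v i))).ennreal_ofReal
  have hml : Measurable fun x => ENNReal.ofReal (frobSq (tfSym (jac v x))) :=
    (continuous_frobSq.measurable.comp (continuous_tfSym.measurable.comp
      (measurable_pi_lambda _ fun i => measurable_pi_lambda _ fun j =>
        measurable_pd j (v i)))).ennreal_ofReal
  set X : ℝ≥0∞ := ∫⁻ x in Ω, ENNReal.ofReal (frobSq (jac v x)) with hXdef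
  set L : ℝ≥0∞ := ∫⁻ x in Ω, ENNReal.ofReal (frobSq (tfSym (jac v x))) with hLdef
  set V : ℝ≥0∞ := ∫⁻ x in Ω, ENNReal.ofReal (∑ i, v i x ^ 2) with hVdef
  set Xq : ι → ℝ≥0∞ := fun q => ∫⁻ x in ball (c q) (7 * R q), ENNReal.ofReal (frobSq (jac v x))
    with hXq
  set Lq : ι → ℝ≥0∞ := fun q =>
    ∫⁻ x in ball (c q) (7 * R q), ENNReal.ofReal (frobSq (tfSym (jac v x))) with hLq
  have hball7 : ∀ q, ball (c q) (7 * R q) ⊆ Ω := fun q =>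
    (ball_subset_ball (by linarith [h.pos q])).trans (h.ball_subset q)
  have hball4 : ∀ q, ball (c q) (4 * R q) ⊆ Ω := fun q =>
    (ball_subset_ball (by linarith [h.pos q])).trans (h.ball_subset q)
  have hXqt : ∀ q, Xq q ≠ ∞ := fun q => ne_top_of_le_ne_top hX (lintegral_mono_set (hball7 q))
  have hLX : ∀ q, Lq q ≤ Xq q := fun q =>
    lintegral_mono fun x => ENNReal.ofReal_le_ofReal (frobSq_tfSym_le _)
  have hLqt : ∀ q, Lq q ≠ ∞ := fun q => ne_top_of_le_ne_top (hXqt q) (hLX q)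
  set W : ι → ℝ≥0∞ := fun q =>
    ENNReal.ofReal (16 + D) * Lq q + ENNReal.ofReal (Ca * δ ^ 2) * Xq q with hW
  have hWt : ∀ q, W q ≠ ∞ := fun q => by
    have := hLqt q
    have := hXqt q
    finiteness
  set w : ι → ℝ := fun q => √((W q).toReal / R q ^ n) with hw
  have hwsq : ∀ q, w q ^ 2 = (W q).toReal / R q ^ n := fun q =>
    Real.sq_sqrt (div_nonneg ENNReal.toReal_nonneg (pow_nonneg (h.pos q).le n))
  have hwW : ∀ q, ENNReal.ofReal (w q ^ 2 * R q ^ n) = W q := fun q => by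
    rw [hwsq, div_mul_cancel₀ _ (pow_pos (h.pos q) n).ne', ENNReal.ofReal_toReal (hWt q)]
  set T : ℝ≥0∞ := ENNReal.ofReal K * (ENNReal.ofReal (16 + D) * L +
    ENNReal.ofReal (Ca * δ ^ 2) * X) + Cr * V with hT
  have hWT : ∑' q, ENNReal.ofReal (w q ^ 2 * R q ^ n) ≤ T := by
    simp only [hwW, hW]
    rw [ENNReal.tsum_add, ENNReal.tsum_mul_left, ENNReal.tsum_mul_left]
    calc _ ≤ ENNReal.ofReal (16 + D) * (ENNReal.ofReal K * L) +
          ENNReal.ofReal (Ca * δ ^ 2) * (ENNReal.ofReal K * X) := by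
          gcongr
          · exact h.overlap _ hml
          · exact h.overlap _ hmj
      _ = ENNReal.ofReal K * (ENNReal.ofReal (16 + D) * L +
          ENNReal.ofReal (Ca * δ ^ 2) * X) := by ring
      _ ≤ T := le_self_add
  have hvV : ∀ k, ∫⁻ x in Ω, ‖v k x‖ₑ ^ 2 ≤ V := fun k => lintegral_mono fun x => by
    rw [enorm_sq_eq_ofReal]
    exact ENNReal.ofReal_le_ofReal (Finset.single_le_sum (f := fun i => v i x ^ 2)
      (fun _ _ => sq_nonneg _) (Finset.mem_univ k))
  have hcomp : ∀ k b, ∫⁻ x in Ω, ‖pd b (v k) x‖ₑ ^ 2 ≤ C₁ * T := by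
    intro k b
    have hfm : Measurable (Ω.indicator (pd b (v k))) :=
      (measurable_pd b (v k)).indicator hΩo.measurableSet
    have hfe : ∫⁻ x in Ω, ‖Ω.indicator (pd b (v k)) x‖ₑ ^ 2 = ∫⁻ x in Ω, ‖pd b (v k) x‖ₑ ^ 2 :=
      setLIntegral_congr_fun hΩo.measurableSet fun x hx => by
        simp only [indicator_of_mem hx]
    rw [← hfe]
    refine hhardy _ (fun q => pd b (g q k)) w T hfm
      ((hvd k b).integrable_indicator hΩo.measurableSet).locallyIntegrable ?_
      (fun q => contDiff_pd b (hg q k)) (fun q => Real.sqrt_nonneg _) (fun q => ?_)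
      (fun q x hx a b' => ?_) hWT ?_ fun a => ?_
    · rw [hfe]
      refine ne_top_of_le_ne_top hX (lintegral_mono fun x => ?_)
      rw [enorm_sq_eq_ofReal]
      exact ENNReal.ofReal_le_ofReal (sq_le_frobSq (jac v x) k b)
    · rw [hwW]
      calc ∫⁻ x in ball (c q) (4 * R q), ‖Ω.indicator (pd b (v k)) x - pd b (g q k) x‖ₑ ^ 2
          ≤ ∫⁻ x in ball (c q) (4 * R q), ENNReal.ofReal (frobSq (jac v x - jac (g q) x)) :=
            setLIntegral_mono' measurableSet_ball fun x hx => by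
              rw [enorm_sq_eq_ofReal, indicator_of_mem (hball4 q hx)]
              exact ENNReal.ofReal_le_ofReal (sq_le_frobSq (jac v x - jac (g q) x) k b)
        _ ≤ _ := hg4 q
        _ ≤ W q := by
            simp only [hW]
            gcongr
            linarith
    · have hRq := h.pos q
      refine abs_le_of_sq_le_sq ?_ (div_nonneg (Real.sqrt_nonneg _) (by positivity))
      refine (ENNReal.ofReal_le_ofReal_iff (by positivity)).1 ((hgD q x hx a b' b k).trans ?_)
      rw [div_pow, hwsq, div_div, ← pow_mul, ← pow_add, div_eq_mul_one_div D,
        div_eq_mul_one_div (W q).toReal, ENNReal.ofReal_mul hD.le,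
        ENNReal.ofReal_mul ENNReal.toReal_nonneg, ENNReal.ofReal_toReal (hWt q), mul_right_comm]
      gcongr
      simp only [hW]
      calc ENNReal.ofReal D * Lq q ≤ ENNReal.ofReal (16 + D) * Lq q := by
            gcongr
            linarith
        _ ≤ _ := le_self_add
    · calc _ ≤ B * ∫⁻ x in Ω, ‖v k x‖ₑ ^ 2 := hBv (v k) (hv k) (hvi k) (hvd k) b
        _ ≤ Cr * V := by
            gcongr
            · exact le_self_add
            · exact hvV k
        _ ≤ T := le_add_self
    · calc _ ≤ B' a * ∫⁻ x in Ω, ‖v k x‖ₑ ^ 2 := hBv' a (v k) (hv k) (hvi k) (hvd k) b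
        _ ≤ Cr * V := by
            gcongr
            · exact (Finset.single_le_sum (f := B') (fun _ _ => zero_le)
                (Finset.mem_univ a)).trans le_add_self
            · exact hvV k
        _ ≤ T := le_add_self
  have hXT : X ≤ n * n * C₁ * T := by
    rw [hXdef, lintegral_frobSq (P := jac v) fun i j => measurable_pd j (v i)]
    calc _ ≤ ∑ _k : Fin n, ∑ _b : Fin n, C₁ * T :=
          Finset.sum_le_sum fun k _ => Finset.sum_le_sum fun b _ => hcomp k b
      _ = n * n * C₁ * T := by
          simp only [Finset.sum_const, Finset.card_univ, Fintype.card_fin, nsmul_eq_mul]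
          ring
  have hβ : n * n * C₁ * (ENNReal.ofReal K * ENNReal.ofReal (Ca * δ ^ 2)) ≤ 2⁻¹ := by
    have e : n * n * C₁ * (ENNReal.ofReal K * ENNReal.ofReal (Ca * δ ^ 2)) =
        ENNReal.ofReal (n * n * C₁.toReal * K * Ca * δ ^ 2) := by
      rw [mul_assoc (_ * K) Ca (δ ^ 2), mul_assoc _ K, ENNReal.ofReal_mul (p := _ * C₁.toReal)
        (by positivity), ENNReal.ofReal_mul (p := _ * _) (by positivity),
        ENNReal.ofReal_mul (p := (n : ℝ)) (by positivity), ENNReal.ofReal_mul (p := K) hK.le,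
        ENNReal.ofReal_natCast, ENNReal.ofReal_toReal hC₁]
    rw [e]
    refine (ENNReal.ofReal_le_ofReal hδM).trans (le_of_eq ?_)
    rw [one_div, ENNReal.ofReal_inv_of_pos two_pos, ENNReal.ofReal_ofNat]
  refine (ENNReal.le_two_mul_of_le_add (α := n * n * C₁ *
    (ENNReal.ofReal K * ENNReal.ofReal (16 + D) * L + Cr * V)) hX hβ (hXT.trans (le_of_eq ?_))).trans ?_
  · rw [hT]
    ring
  · rw [mul_assoc 2, mul_assoc (_ * C₁)]
    gcongr
    calc _ ≤ ENNReal.ofReal K * ENNReal.ofReal (16 + D) * (V + L) + Cr * (V + L) := by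
          gcongr
          · exact le_add_self
          · exact le_self_add
      _ = _ := by ring

lemma pd_apply_eq_Dmat {n : ℕ} {v : Euc n → Euc n} {x : Euc n} (hv : DifferentiableAt ℝ v x)
    (i j : Fin n) : pd j (fun y => v y i) x = Dmat v x i j := by
  have h := ((EuclideanSpace.proj i : Euc n →L[ℝ] ℝ).hasFDerivAt.comp x
    hv.hasFDerivAt).fderiv
  exact congrArg (fun T : Euc n →L[ℝ] ℝ => T (EuclideanSpace.single j 1)) h

lemma jac_apply_eq_Dmat {n : ℕ} {v : Euc n → Euc n} {x : Euc n} (hv : DifferentiableAt ℝ v x) :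
    jac (fun i y => v y i) x = Dmat v x := by
  ext i j
  exact pd_apply_eq_Dmat hv i j

lemma matNorm_sq {n : ℕ} (M : Matrix (Fin n) (Fin n) ℝ) : matNorm M ^ 2 = frobSq M :=
  Real.sq_sqrt (frobSq_nonneg M)

lemma lMat_eq_tfSym {n : ℕ} (v : Euc n → Euc n) (x : Euc n) :
    lMat v x = tfSym (Dmat v x) := by
  ext i j
  simp only [lMat, epsMat, tfSym, Matrix.sub_apply, Matrix.smul_apply, Matrix.add_apply,
    Matrix.transpose_apply, Matrix.trace, Matrix.diag_apply, Matrix.one_apply, smul_eq_mul]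
  split_ifs <;> ring

lemma Real.sqrt_mul_add_le {C x y : ℝ} (hC : 0 ≤ C) (hx : 0 ≤ x) (hy : 0 ≤ y) :
    √(C * (x + y)) ≤ √C * (√x + √y) := by
  rw [Real.sqrt_mul hC]
  gcongr
  refine Real.sqrt_le_iff.2 ⟨by positivity, ?_⟩
  nlinarith [Real.sq_sqrt hx, Real.sq_sqrt hy, mul_nonneg (Real.sqrt_nonneg x) (Real.sqrt_nonneg y)]

lemma integrable_of_sq_le {X : Type*} [MeasurableSpace X] {μ : Measure X} [IsFiniteMeasure μ]
    {f g : X → ℝ} (hf : AEStronglyMeasurable f μ) (hg : Integrable g μ)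
    (h : ∀ᵐ x ∂μ, f x ^ 2 ≤ g x) : Integrable f μ := by
  refine ((integrable_const (1 : ℝ)).add hg).mono' hf (h.mono fun x hx => ?_)
  rw [Real.norm_eq_abs, Pi.add_apply]
  nlinarith [sq_nonneg (|f x| - 1), sq_abs (f x)]

/-- Dain's inequality on bounded John domains (`n ≥ 3`):
`‖v‖_{W^{1,2}(Ω)} ≤ C (‖v‖_{L²(Ω)} + ‖l(v)‖_{L²(Ω)})`. -/
theorem dain_inequality_on_john_domains
    {n : ℕ} (hn : 3 ≤ n) (Ω : Set (Euc n)) (hΩo : IsOpen Ω) (hΩc : IsConnected Ω)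
    (hΩb : Bornology.IsBounded Ω) (hJ : IsJohnDomain Ω) :
    ∃ C : ℝ, ∀ v : Euc n → Euc n, memW1p Ω 2 v →
      W1pNorm Ω 2 v ≤
        C * ((∫ x in Ω, ‖v x‖ ^ 2) ^ (1 / 2 : ℝ) +
          (∫ x in Ω, matNorm (lMat v x) ^ 2) ^ (1 / 2 : ℝ)) := by
  obtain ⟨C, hC, hCv⟩ := exists_lintegral_frobSq_jac_le hn hΩo hΩb hJ
  refine ⟨√(1 + C.toReal), ?_⟩
  rintro v ⟨hv, hvi, hvd⟩
  simp only [W1pNorm, Real.rpow_two, matNorm_sq, ← Real.sqrt_eq_rpow] at hvi hvd ⊢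
  have : IsFiniteMeasure (volume.restrict Ω) :=
    isFiniteMeasure_restrict.2 hΩb.measure_lt_top.ne
  have hnorm : ∀ x, ‖v x‖ ^ 2 = ∑ i, v x i ^ 2 := fun x => by
    simp [EuclideanSpace.norm_sq_eq]
  set u : Fin n → Euc n → ℝ := fun i y => v y i with hu
  have hjac : ∀ x ∈ Ω, jac u x = Dmat v x := fun x hx => jac_apply_eq_Dmat (hv x hx)
  have hud : ∀ i, ∀ x ∈ Ω, DifferentiableAt ℝ (u i) x := fun i x hx =>
    (EuclideanSpace.proj i : Euc n →L[ℝ] ℝ).differentiableAt.comp x (hv x hx)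
  have hui : ∀ i, IntegrableOn (u i) Ω := fun i =>
    integrable_of_sq_le (ContinuousOn.aestronglyMeasurable
      (fun x hx => (hud i x hx).continuousAt.continuousWithinAt) hΩo.measurableSet) hvi
      (.of_forall fun x => by
        rw [hnorm]
        exact Finset.single_le_sum (f := fun i => v x i ^ 2) (fun _ _ => sq_nonneg _)
          (Finset.mem_univ i))
  have hjd : IntegrableOn (fun x => frobSq (jac u x)) Ω :=
    hvd.congr_fun (fun x hx => by simp only [hjac x hx]) hΩo.measurableSet
  have hupd : ∀ i j, IntegrableOn (pd j (u i)) Ω := fun i j =>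
    integrable_of_sq_le (measurable_pd j (u i)).aestronglyMeasurable hjd
      (.of_forall fun x => sq_le_frobSq (jac u x) i j)
  have hld : IntegrableOn (fun x => frobSq (tfSym (jac u x))) Ω := by
    refine hjd.mono' ?_ (.of_forall fun x => ?_)
    · exact (continuous_frobSq.measurable.comp (continuous_tfSym.measurable.comp
        (measurable_pi_lambda _ fun i => measurable_pi_lambda _ fun j =>
          measurable_pd j (u i)))).aestronglyMeasurable
    · rw [Real.norm_of_nonneg (frobSq_nonneg _)]
      exact frobSq_tfSym_le _
  have hmain := hCv u hud hui hupd hjd.lintegral_lt_top.ne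
  have eX : ∫ x in Ω, frobSq (Dmat v x) = ∫ x in Ω, frobSq (jac u x) :=
    setIntegral_congr_fun hΩo.measurableSet fun x hx => by simp only [hjac x hx]
  have eL : ∫ x in Ω, frobSq (lMat v x) = ∫ x in Ω, frobSq (tfSym (jac u x)) :=
    setIntegral_congr_fun hΩo.measurableSet fun x hx => by simp only [hjac x hx, lMat_eq_tfSym]
  have hV0 : 0 ≤ ∫ x in Ω, ‖v x‖ ^ 2 := integral_nonneg fun x => sq_nonneg _
  have hL0 : 0 ≤ ∫ x in Ω, frobSq (tfSym (jac u x)) := integral_nonneg fun x => frobSq_nonneg _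
  have hV : ∫⁻ x in Ω, ENNReal.ofReal (∑ i, u i x ^ 2) =
      ENNReal.ofReal (∫ x in Ω, ‖v x‖ ^ 2) := by
    rw [ofReal_integral_eq_lintegral_ofReal hvi (.of_forall fun x => sq_nonneg _)]
    simp only [hnorm, hu]
  rw [hV, ← ofReal_integral_eq_lintegral_ofReal hjd (.of_forall fun x => frobSq_nonneg _),
    ← ofReal_integral_eq_lintegral_ofReal hld (.of_forall fun x => frobSq_nonneg _),
    ← ENNReal.ofReal_add hV0 hL0, ← ENNReal.ofReal_toReal hC,
    ← ENNReal.ofReal_mul ENNReal.toReal_nonneg,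
    ENNReal.ofReal_le_ofReal_iff (mul_nonneg ENNReal.toReal_nonneg (add_nonneg hV0 hL0))] at hmain
  rw [eX, eL]
  refine le_trans (Real.sqrt_le_sqrt ?_) (Real.sqrt_mul_add_le (by positivity) hV0 hL0)
  linarith


end
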